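/- arXiv:1105.3021 — 3 statements merged into one kernel-verified Lean document; each statement's English description precedes it below -/
import Mathlib

section
/- Let 1 ≤ p₁ < 2. Then there is a constant C > 0, independent of N and k, such that for all N, k ∈ ℕ: d_k(id : ℓ_{p₁}^N → ℓ_∞^N) ≤ C · k^{−1/2} (log(4eN/k))^{3/2} if k ≤ N, and d_k(id : ℓ_{p₁}^N → ℓ_∞^N) = 0 if k > N. -/
open scoped ENNReal

instance : Fact ((1 : ℝ≥0∞) ≤ ∞) := ⟨le_top⟩

/-- The `k`-th Kolmogorov number of a continuous linear operator `T : X → Y`. -/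
noncomputable def kolmogorovNumber {X Y : Type*} [NormedAddCommGroup X] [NormedSpace ℂ X]
    [NormedAddCommGroup Y] [NormedSpace ℂ Y] (T : X →L[ℂ] Y) (k : ℕ) : ℝ :=
  sInf { r | ∃ L : Submodule ℂ Y, Module.rank ℂ L < (k : Cardinal) ∧
    r = ⨆ x : {x : X // ‖x‖ ≤ 1}, ⨅ z : L, ‖T x.1 - (z : Y)‖ }

/-- The identity operator `id : ℓ_{p₁}^N → ℓ_{p₂}^N` on `ℂ^N`. -/
noncomputable def lpId (p₁ p₂ : ℝ≥0∞) [Fact (1 ≤ p₁)] [Fact (1 ≤ p₂)] (N : ℕ) :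
    PiLp p₁ (fun _ : Fin N => ℂ) →L[ℂ] PiLp p₂ (fun _ : Fin N => ℂ) :=
  LinearMap.toContinuousLinearMap
    (((WithLp.linearEquiv p₂ ℂ (Fin N → ℂ)).symm.toLinearMap).comp
      (WithLp.linearEquiv p₁ ℂ (Fin N → ℂ)).toLinearMap)

/-- The real sign `±1` encoded by a Boolean. -/
def boolSign (b : Bool) : ℝ := if b then 1 else -1

lemma boolSign_sq (b : Bool) : boolSign b ^ 2 = 1 := by cases b <;> simp [boolSign]

/-- The Rademacher sum `∑ ε i * y i`. -/
noncomputable def signSum {n : ℕ} (ε : Fin n → Bool) : (Fin n → ℝ) →ₗ[ℝ] ℝ :=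
  ∑ i, boolSign (ε i) • LinearMap.proj i

lemma signSum_apply {n : ℕ} (ε : Fin n → Bool) (y : Fin n → ℝ) :
    signSum ε y = ∑ i, boolSign (ε i) * y i := by
  simp [signSum]

lemma signSum_single {n : ℕ} (ε : Fin n → Bool) (i : Fin n) (c : ℝ) :
    signSum ε (Pi.single i c) = boolSign (ε i) * c := by
  simp [signSum_apply, Pi.single_apply]

lemma signSum_cons {n : ℕ} (b : Bool) (ε : Fin n → Bool) (y : Fin (n + 1) → ℝ) :
    signSum (Fin.cons b ε) y = boolSign b * y 0 + signSum ε (Fin.tail y) := by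
  simp [signSum_apply, Fin.sum_univ_succ, Fin.tail]

lemma sum_bool_pi_succ {n : ℕ} (f : (Fin (n + 1) → Bool) → ℝ) :
    ∑ ε, f ε = ∑ ε : Fin n → Bool, (f (Fin.cons true ε) + f (Fin.cons false ε)) := by
  rw [← (Fin.consEquiv fun _ : Fin (n + 1) => Bool).sum_comp, Fintype.sum_prod_type,
    Fintype.sum_bool, ← Finset.sum_add_distrib]
  rfl

lemma sum_signSum_sq {n : ℕ} (y : Fin n → ℝ) :
    ∑ ε, signSum ε y ^ 2 = 2 ^ n * ∑ i, y i ^ 2 := by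
  induction n with
  | zero => simp [signSum_apply]
  | succ n ih =>
    rw [sum_bool_pi_succ, Fin.sum_univ_succ]
    have h : ∀ ε : Fin n → Bool, signSum (Fin.cons true ε) y ^ 2 + signSum (Fin.cons false ε) y ^ 2
        = 2 * y 0 ^ 2 + 2 * signSum ε (Fin.tail y) ^ 2 := by
      intro ε
      simp only [signSum_cons, boolSign]
      norm_num
      ring
    simp only [h, Finset.sum_add_distrib, ← Finset.mul_sum, ih]
    simp [Fin.tail]
    ring

lemma sum_signSum_four_le {n : ℕ} (y : Fin n → ℝ) :
    ∑ ε, signSum ε y ^ 4 ≤ 2 ^ n * (3 * (∑ i, y i ^ 2) ^ 2) := by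
  induction n with
  | zero => simp [signSum_apply]
  | succ n ih =>
    rw [sum_bool_pi_succ, Fin.sum_univ_succ]
    have h : ∀ ε : Fin n → Bool, signSum (Fin.cons true ε) y ^ 4 + signSum (Fin.cons false ε) y ^ 4
        = 2 * y 0 ^ 4 + 12 * y 0 ^ 2 * signSum ε (Fin.tail y) ^ 2
          + 2 * signSum ε (Fin.tail y) ^ 4 := by
      intro ε
      simp only [signSum_cons, boolSign]
      norm_num
      ring
    have h4 := ih (Fin.tail y)
    simp only [h, Finset.sum_add_distrib, ← Finset.mul_sum, sum_signSum_sq]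
    simp only [Fin.tail] at h4 ⊢
    simp only [Finset.sum_const, Finset.card_univ, Fintype.card_pi, Fintype.card_bool,
      Finset.prod_const, Fintype.card_fin, nsmul_eq_mul]
    push_cast
    have h0 : 0 ≤ (2 : ℝ) ^ n * y 0 ^ 4 := by positivity
    rw [pow_succ (2 : ℝ) n]
    nlinarith

lemma exp_neg_le_quadratic {u : ℝ} (hu : 0 ≤ u) : Real.exp (-u) ≤ 1 - u + u ^ 2 / 2 := by
  have h := Real.quadratic_le_exp_of_nonneg hu
  have h1 : 0 < 1 - u + u ^ 2 / 2 := by nlinarith [sq_nonneg (u - 1)]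
  rw [Real.exp_neg, inv_le_iff_one_le_mul₀ (Real.exp_pos u)]
  nlinarith [mul_le_mul_of_nonneg_left h h1.le, sq_nonneg (u ^ 2)]

lemma sum_exp_neg_signSum_le {n : ℕ} (y : Fin n → ℝ) (hy : 0 < ∑ i, y i ^ 2) :
    ∑ ε, Real.exp (-(signSum ε y ^ 2 / (3 * ∑ i, y i ^ 2))) ≤ 2 ^ n * (5 / 6) := by
  have h2 := sum_signSum_sq y
  have h4 := sum_signSum_four_le y
  set V := ∑ i, y i ^ 2
  calc ∑ ε, Real.exp (-(signSum ε y ^ 2 / (3 * V)))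
      ≤ ∑ ε : Fin n → Bool, (1 - 1 / (3 * V) * signSum ε y ^ 2
          + 1 / (18 * V ^ 2) * signSum ε y ^ 4) := by
        refine Finset.sum_le_sum fun ε _ => (exp_neg_le_quadratic (by positivity)).trans_eq ?_
        field_simp
        ring
    _ = 2 ^ n - 1 / (3 * V) * (2 ^ n * V) + 1 / (18 * V ^ 2) * ∑ ε, signSum ε y ^ 4 := by
        simp only [Finset.sum_add_distrib, Finset.sum_sub_distrib, ← Finset.mul_sum, h2]
        simp
    _ ≤ 2 ^ n - 1 / (3 * V) * (2 ^ n * V) + 1 / (18 * V ^ 2) * (2 ^ n * (3 * V ^ 2)) := by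
        gcongr
    _ = 2 ^ n * (5 / 6) := by
        field_simp
        ring

/-- A sign matrix that is bounded below on each of finitely many given vectors. -/
lemma exists_sign_matrix {n m : ℕ} (Y : Finset (Fin n → ℝ)) (hY : ∀ y ∈ Y, 0 < ∑ i, y i ^ 2)
    (hcard : Y.card * (5 / 6 : ℝ) ^ m < Real.exp (-(m / 96))) :
    ∃ A : Fin m → Fin n → Bool, ∀ y ∈ Y,
      m / 32 * ∑ i, y i ^ 2 < ∑ r, signSum (A r) y ^ 2 := by
  by_contra! hbad
  have hupper : ∀ y ∈ Y, ∑ A : Fin m → Fin n → Bool,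
      Real.exp (-((∑ r, signSum (A r) y ^ 2) / (3 * ∑ i, y i ^ 2))) ≤ (2 ^ n * (5 / 6)) ^ m := by
    intro y hy
    refine le_trans (le_of_eq ?_)
      (pow_le_pow_left₀ (Finset.sum_nonneg fun _ _ => (Real.exp_pos _).le)
        (sum_exp_neg_signSum_le y (hY y hy)) m)
    rw [Fintype.sum_pow]
    refine Finset.sum_congr rfl fun A _ => ?_
    rw [← Real.exp_sum, Finset.sum_neg_distrib, Finset.sum_div]
  have hlower : ∀ A : Fin m → Fin n → Bool, Real.exp (-(m / 96)) ≤
      ∑ y ∈ Y, Real.exp (-((∑ r, signSum (A r) y ^ 2) / (3 * ∑ i, y i ^ 2))) := by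
    intro A
    obtain ⟨y, hy, hyA⟩ := hbad A
    refine le_trans ?_ (Finset.single_le_sum
      (f := fun y => Real.exp (-((∑ r, signSum (A r) y ^ 2) / (3 * ∑ i, y i ^ 2))))
      (fun _ _ => (Real.exp_pos _).le) hy)
    have hV := hY y hy
    refine Real.exp_le_exp.2 (neg_le_neg ?_)
    rw [div_le_iff₀ (by positivity)]
    linarith
  have h1 := Finset.sum_le_sum fun A (_ : A ∈ Finset.univ) => hlower A
  rw [Finset.sum_comm] at h1
  have h2 := h1.trans (Finset.sum_le_sum hupper)
  simp only [Finset.sum_const, Finset.card_univ, Fintype.card_pi, Fintype.card_bool,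
    Finset.prod_const, Fintype.card_fin, nsmul_eq_mul, mul_pow] at h2
  push_cast at h2
  have h3 : (0 : ℝ) < (2 ^ n) ^ m := by positivity
  nlinarith

/-- Maurey's empirical method. -/
lemma exists_multiset_norm_sub_sum_sq_le {ι H : Type*} [Fintype ι] [NormedAddCommGroup H]
    [InnerProductSpace ℝ H] (b : ι → H) (w : ι → ℝ) (hw : ∀ i, 0 ≤ w i) (hw1 : ∑ i, w i = 1)
    {B : ℝ} (hb : ∀ i, ‖b i‖ ^ 2 ≤ B) (t : ℕ) :
    ∃ s : Multiset ι, s.card = t ∧ ‖(t : ℝ) • ∑ i, w i • b i - (s.map b).sum‖ ^ 2 ≤ t * B := by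
  induction t with
  | zero => exact ⟨0, by simp⟩
  | succ t ih =>
    obtain ⟨s, hs, hsB⟩ := ih
    set μ := ∑ i, w i • b i with hμ
    set S := (t : ℝ) • μ - (s.map b).sum
    have hav : ∑ i, w i * ‖S + (μ - b i)‖ ^ 2 ≤ ∑ i, w i * (‖S‖ ^ 2 + B) := by
      have hi : ∀ i, w i * ‖S + (μ - b i)‖ ^ 2 = w i * ‖S + μ‖ ^ 2
          - 2 * inner ℝ (S + μ) (w i • b i) + w i * ‖b i‖ ^ 2 := by
        intro i
        rw [← add_sub_assoc, norm_sub_sq_real, inner_smul_right]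
        ring
      have hSμ : ‖S + μ‖ ^ 2 - 2 * inner ℝ (S + μ) μ = ‖S‖ ^ 2 - ‖μ‖ ^ 2 := by
        rw [norm_add_sq_real, inner_add_left, real_inner_self_eq_norm_sq]
        ring
      have hB : ∑ i, w i * ‖b i‖ ^ 2 ≤ B := by
        calc _ ≤ ∑ i, w i * B :=
              Finset.sum_le_sum fun i _ => mul_le_mul_of_nonneg_left (hb i) (hw i)
          _ = B := by rw [← Finset.sum_mul, hw1, one_mul]
      simp only [hi, Finset.sum_add_distrib, Finset.sum_sub_distrib, ← Finset.mul_sum,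
        ← Finset.sum_mul, hw1, ← inner_sum, ← hμ]
      nlinarith [sq_nonneg ‖μ‖]
    obtain ⟨i, hi⟩ : ∃ i, 0 < w i ∧ ‖S + (μ - b i)‖ ^ 2 ≤ ‖S‖ ^ 2 + B := by
      by_contra! hcon
      obtain ⟨j, -, hj⟩ : ∃ j ∈ Finset.univ, (0 : ℝ) < w j :=
        Finset.exists_lt_of_sum_lt (by simp [hw1])
      refine hav.not_gt (Finset.sum_lt_sum (fun i _ => ?_)
        ⟨j, Finset.mem_univ _, mul_lt_mul_of_pos_left (hcon j hj) hj⟩)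
      rcases (hw i).eq_or_lt with h | h
      · simp [← h]
      · exact mul_le_mul_of_nonneg_left (hcon i h).le h.le
    refine ⟨i ::ₘ s, by simp [hs], ?_⟩
    have he : ((t + 1 : ℕ) : ℝ) • μ - ((i ::ₘ s).map b).sum = S + (μ - b i) := by
      simp only [S, Multiset.map_cons, Multiset.sum_cons]
      push_cast
      module
    rw [he]
    push_cast
    linarith [hi.2]

/-- The map `v ↦ (√m v, A v)` for a sign matrix `A` with `m` rows. -/
noncomputable def signEmbedding {n m : ℕ} (A : Fin m → Fin n → Bool) :
    (Fin n → ℝ) →ₗ[ℝ] EuclideanSpace ℝ (Fin n ⊕ Fin m) :=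
  (WithLp.linearEquiv 2 ℝ (Fin n ⊕ Fin m → ℝ)).symm.toLinearMap ∘ₗ
    LinearMap.pi (Sum.elim (fun i => √m • LinearMap.proj i) fun r => signSum (A r))

lemma norm_signEmbedding_sq {n m : ℕ} (A : Fin m → Fin n → Bool) (v : Fin n → ℝ) :
    ‖signEmbedding A v‖ ^ 2 = m * ∑ i, v i ^ 2 + ∑ r, signSum (A r) v ^ 2 := by
  rw [EuclideanSpace.norm_sq_eq, Fintype.sum_sum_type, Finset.mul_sum]
  simp [signEmbedding, mul_pow]

/-- The signed unit vector `± e_i`. -/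
noncomputable def signVec {n : ℕ} (a : Fin n × Bool) : Fin n → ℝ := Pi.single a.1 (boolSign a.2)

/-- The nonzero sums of `t` signed unit vectors. -/
noncomputable def signNet (n t : ℕ) : Finset (Fin n → ℝ) :=
  open Classical in
  (Finset.univ.image fun s : Sym (Fin n × Bool) t =>
    ((s : Multiset (Fin n × Bool)).map signVec).sum).filter fun y => 0 < ∑ i, y i ^ 2

lemma norm_signEmbedding_signVec_sq {n m : ℕ} (A : Fin m → Fin n → Bool) (a : Fin n × Bool) :
    ‖signEmbedding A (signVec a)‖ ^ 2 = 2 * m := by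
  have h : ∑ i, signVec a i ^ 2 = 1 := by
    simp [signVec, Pi.single_apply, ite_pow, boolSign_sq]
  rw [norm_signEmbedding_sq, h]
  simp [signVec, signSum_single, mul_pow, boolSign_sq]
  ring

lemma sum_max_mul_signVec {n : ℕ} (x : Fin n → ℝ) :
    ∑ a : Fin n × Bool, max (boolSign a.2 * x a.1) 0 • signVec a = x := by
  ext j
  have h : ∀ i, max (x i) 0 * (Pi.single i 1 : Fin n → ℝ) j
      + max (-x i) 0 * (Pi.single i (-1) : Fin n → ℝ) j = if j = i then x i else 0 := by
    intro i
    by_cases hij : j = i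
    · subst hij
      rcases le_total 0 (x j) with h | h <;> simp [h]
    · simp [hij]
  simp [Fintype.sum_prod_type, signVec, boolSign, h]

lemma sum_max_mul_boolSign {n : ℕ} (x : Fin n → ℝ) :
    ∑ a : Fin n × Bool, max (boolSign a.2 * x a.1) 0 = ∑ i, |x i| := by
  rw [Fintype.sum_prod_type]
  refine Finset.sum_congr rfl fun i _ => ?_
  rcases le_total 0 (x i) with h | h <;> simp [boolSign, h, abs_of_nonneg, abs_of_nonpos]

lemma sum_sq_le_of_signSum_eq_zero_of_sum_abs_eq_one {n m t : ℕ} (hm : 0 < m) (ht : 0 < t)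
    {A : Fin m → Fin n → Bool}
    (hA : ∀ y ∈ signNet n t, m / 32 * ∑ i, y i ^ 2 < ∑ r, signSum (A r) y ^ 2)
    {x : Fin n → ℝ} (hx : ∀ r, signSum (A r) x = 0) (hx1 : ∑ i, |x i| = 1) :
    t * ∑ i, x i ^ 2 ≤ 200 := by
  obtain ⟨s, hs, hsB⟩ := exists_multiset_norm_sub_sum_sq_le
    (fun a : Fin n × Bool => signEmbedding A (signVec a))
    (fun a => max (boolSign a.2 * x a.1) 0) (fun _ => le_max_right _ _)
    ((sum_max_mul_boolSign x).trans hx1) (fun a => (norm_signEmbedding_signVec_sq A a).le) t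
  set z := (s.map signVec).sum with hz
  have he : (t : ℝ) • ∑ a : Fin n × Bool, max (boolSign a.2 * x a.1) 0 •
      signEmbedding A (signVec a) - (s.map fun a => signEmbedding A (signVec a)).sum
      = signEmbedding A ((t : ℝ) • x - z) := by
    rw [map_sub, map_smul, hz, map_multiset_sum, Multiset.map_map]
    conv_rhs => rw [← sum_max_mul_signVec x, map_sum]
    simp only [map_smul, Function.comp_def]
  rw [he, norm_signEmbedding_sq] at hsB
  have hAz : ∀ r, signSum (A r) ((t : ℝ) • x - z) ^ 2 = signSum (A r) z ^ 2 := by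
    intro r
    rw [map_sub, map_smul, hx r]
    simp
  simp only [hAz] at hsB
  set D := ∑ i, ((t : ℝ) • x - z) i ^ 2 with hD
  have hm' : (0 : ℝ) < m := by exact_mod_cast hm
  have ht' : (0 : ℝ) < t := by exact_mod_cast ht
  have hDt : D ≤ 2 * t := by
    have : 0 ≤ ∑ r, signSum (A r) z ^ 2 := Finset.sum_nonneg fun _ _ => sq_nonneg _
    refine le_of_mul_le_mul_left ?_ hm'
    linarith
  have hX : (t : ℝ) ^ 2 * ∑ i, x i ^ 2 ≤ 2 * D + 2 * ∑ i, z i ^ 2 := by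
    rw [hD, Finset.mul_sum, Finset.mul_sum, Finset.mul_sum, ← Finset.sum_add_distrib]
    refine Finset.sum_le_sum fun i _ => ?_
    simp only [Pi.sub_apply, Pi.smul_apply, smul_eq_mul]
    nlinarith [sq_nonneg (t * x i - 2 * z i)]
  by_contra! hcon
  have hZ : 98 * (t : ℝ) < ∑ i, z i ^ 2 := by nlinarith
  have hmem : z ∈ signNet n t := by
    classical
    refine Finset.mem_filter.2 ⟨Finset.mem_image.2 ⟨⟨s, hs⟩, Finset.mem_univ _, rfl⟩, ?_⟩
    exact lt_trans (by positivity) hZ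
  have h1 := hA z hmem
  have h2 : 0 ≤ D := Finset.sum_nonneg fun _ _ => sq_nonneg _
  nlinarith [mul_pos hm' ht', mul_lt_mul_of_pos_left hZ hm', mul_nonneg hm'.le h2]

lemma sum_sq_le_of_signSum_eq_zero {n m t : ℕ} (hm : 0 < m) (ht : 0 < t)
    {A : Fin m → Fin n → Bool}
    (hA : ∀ y ∈ signNet n t, m / 32 * ∑ i, y i ^ 2 < ∑ r, signSum (A r) y ^ 2)
    {x : Fin n → ℝ} (hx : ∀ r, signSum (A r) x = 0) :
    t * ∑ i, x i ^ 2 ≤ 200 * (∑ i, |x i|) ^ 2 := by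
  rcases (Finset.sum_nonneg fun i (_ : i ∈ Finset.univ) => abs_nonneg (x i)).eq_or_lt with h | h
  · have h0 : ∀ i, x i = 0 := fun i => abs_eq_zero.1
      ((Finset.sum_eq_zero_iff_of_nonneg fun i _ => abs_nonneg (x i)).1 h.symm i
        (Finset.mem_univ i))
    simp [h0]
  · set S := ∑ i, |x i| with hS
    have h1 := sum_sq_le_of_signSum_eq_zero_of_sum_abs_eq_one hm ht hA (x := S⁻¹ • x)
      (fun r => by rw [map_smul, hx r, smul_zero])
      (by simp [abs_mul, ← Finset.mul_sum, abs_of_pos h, ← hS, h.ne'])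
    simp only [Pi.smul_apply, smul_eq_mul, mul_pow, ← Finset.mul_sum] at h1
    field_simp at h1
    linarith

lemma card_signNet_le {n t : ℕ} (ht : 0 < t) (htn : t ≤ n) :
    ((signNet n t).card : ℝ) ≤ Real.exp (t * Real.log (3 * Real.exp 1 * n / t)) := by
  classical
  have ht' : (0 : ℝ) < t := by exact_mod_cast ht
  have hn' : (0 : ℝ) < n := by exact_mod_cast ht.trans_le htn
  have h1 : (signNet n t).card ≤ (3 * n).choose t := by
    refine (Finset.card_filter_le _ _).trans (Finset.card_image_le.trans ?_)
    rw [Finset.card_univ, Sym.card_sym_eq_choose]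
    refine Nat.choose_le_choose t ?_
    simp
    omega
  have hf := Real.pow_div_factorial_le_exp t ht'.le t
  rw [div_le_iff₀ (by positivity)] at hf
  calc ((signNet n t).card : ℝ) ≤ ((3 * n).choose t : ℕ) := by exact_mod_cast h1
    _ ≤ ((3 * n : ℕ) : ℝ) ^ t / t.factorial := Nat.choose_le_pow_div _ _
    _ ≤ (3 * Real.exp 1 * n / t) ^ t := by
      rw [div_pow, div_le_div_iff₀ (by positivity) (by positivity)]
      push_cast
      rw [mul_right_comm 3, mul_pow (3 * (n : ℝ)), Real.exp_one_pow, mul_assoc]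
      gcongr
    _ = Real.exp (t * Real.log (3 * Real.exp 1 * n / t)) := by
      rw [Real.exp_nat_mul, Real.exp_log (by positivity)]

lemma two_le_log_ratio {N k : ℕ} (hk : 1 ≤ k) (hkN : k ≤ N) :
    2 ≤ Real.log (4 * Real.exp 1 * N / k) := by
  have hk' : (0 : ℝ) < k := by exact_mod_cast hk
  have hkN' : (k : ℝ) ≤ N := by exact_mod_cast hkN
  have h4 : 1 ≤ Real.log 4 := by
    rw [show (4 : ℝ) = 2 ^ 2 by norm_num, Real.log_pow]
    push_cast
    linarith [Real.log_two_gt_d9]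
  calc 2 ≤ Real.log 4 + Real.log (Real.exp 1) := by rw [Real.log_exp]; linarith
    _ = Real.log (4 * Real.exp 1) := (Real.log_mul (by norm_num) (Real.exp_pos 1).ne').symm
    _ ≤ _ := Real.log_le_log (by positivity) (by rw [le_div_iff₀ hk']; gcongr)

/-- There are `k - 1` linear equations whose solutions have small `ℓ_2` norm relative to their
`ℓ_1` norm. -/
lemma exists_sign_matrix_sum_sq_le {N k : ℕ} (hk : 1 ≤ k) (hkN : k ≤ N)
    (hL : 1000 * Real.log (4 * Real.exp 1 * N / k) ^ 3 ≤ k) :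
    ∃ A : Fin (k - 1) → Fin N → Bool, ∀ x : Fin N → ℝ, (∀ r, signSum (A r) x = 0) →
      ∑ i, x i ^ 2 ≤
        400000 * (Real.log (4 * Real.exp 1 * N / k) ^ 3 / k) * (∑ i, |x i|) ^ 2 := by
  have hL2 := two_le_log_ratio hk hkN
  have hk' : (0 : ℝ) < k := by exact_mod_cast hk
  have hkN' : (k : ℝ) ≤ N := by exact_mod_cast hkN
  set q := 4 * Real.exp 1 * N / k with hq
  set L := Real.log q
  have hq10 : 10 ≤ q := by
    rw [hq, le_div_iff₀ hk']
    nlinarith [Real.exp_one_gt_d9]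
  have hLq : L ≤ q := (Real.log_le_sub_one_of_pos (by linarith)).trans (by linarith)
  have hL3 : 8 ≤ L ^ 3 := by nlinarith [pow_le_pow_left₀ (by norm_num) hL2 3]
  set u := k / (1000 * L ^ 3) with hu
  have hu1 : 1 ≤ u := by rwa [hu, le_div_iff₀ (by positivity), one_mul]
  have huk : u ≤ k := div_le_self hk'.le (by linarith)
  set t := ⌊u⌋₊
  have ht : 0 < t := Nat.floor_pos.2 hu1
  have htu : (t : ℝ) ≤ u := Nat.floor_le (by linarith)
  have hut : u < t + 1 := Nat.lt_floor_add_one u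
  have ht1 : (1 : ℝ) ≤ t := by exact_mod_cast ht
  have htN : t ≤ N := by
    have : (t : ℝ) ≤ N := by linarith
    exact_mod_cast this
  have hk2 : 2 ≤ k := by
    have : (2 : ℝ) ≤ k := by linarith
    exact_mod_cast this
  have hm : 0 < k - 1 := by omega
  have hkm : (k : ℝ) ≤ 2 * (k - 1 : ℕ) := by
    have : k ≤ 2 * (k - 1) := by omega
    exact_mod_cast this
  have hratio : 3 * Real.exp 1 * N / t ≤ q ^ 8 := by
    have h1 : 3 * Real.exp 1 * N / t ≤ 1500 * q * L ^ 3 := by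
      have : 1500 * q * L ^ 3 = 3 * Real.exp 1 * N / (u / 2) := by
        rw [hu, hq]
        field_simp
        ring
      rw [this]
      gcongr
      linarith
    have h2 : L ^ 3 ≤ q ^ 3 := pow_le_pow_left₀ (by linarith) hLq 3
    have h3 : (10 : ℝ) ^ 4 ≤ q ^ 4 := pow_le_pow_left₀ (by norm_num) hq10 4
    calc _ ≤ 1500 * q * L ^ 3 := h1
      _ ≤ q ^ 4 * q * q ^ 3 := by gcongr; linarith
      _ = q ^ 8 := by ring
  have hlog : Real.log (3 * Real.exp 1 * N / t) ≤ 8 * L := by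
    have hN : (0 : ℝ) < N := by linarith
    refine (Real.log_le_log (by positivity) hratio).trans_eq ?_
    rw [Real.log_pow]
    norm_num [L]
  have hlog0 : 0 ≤ Real.log (3 * Real.exp 1 * N / t) := by
    refine Real.log_nonneg ((one_le_div (by linarith)).2 ?_)
    nlinarith [Real.exp_one_gt_d9]
  have hexp : t * Real.log (3 * Real.exp 1 * N / t) ≤ (k - 1 : ℕ) * (1 / 250) := by
    calc t * Real.log (3 * Real.exp 1 * N / t) ≤ u * (8 * L) :=
          mul_le_mul htu hlog hlog0 (by linarith)
      _ = k * (8 / (1000 * L ^ 2)) := by rw [hu]; field_simp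
      _ ≤ k * (8 / (1000 * 2 ^ 2)) := by gcongr
      _ ≤ _ := by linarith
  obtain ⟨A, hA⟩ := exists_sign_matrix (m := k - 1) (signNet N t)
    (fun y hy => (Finset.mem_filter.1 hy).2) (by
      have h1 : Real.exp (1 / 250) * (5 / 6) < Real.exp (-(1 / 96)) := by
        have h2 : Real.exp (1 / 250) ≤ 1.01 := by
          have h3 : (1 : ℝ) - 1 / 250 ≤ Real.exp (-(1 / 250)) := by
            linarith [Real.add_one_le_exp (-(1 / 250 : ℝ))]
          rw [← inv_inv (Real.exp (1 / 250)), ← Real.exp_neg]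
          refine inv_le_of_inv_le₀ (by norm_num) (le_trans ?_ h3)
          norm_num
        have h4 := Real.add_one_le_exp (-(1 / 96 : ℝ))
        linarith
      calc ((signNet N t).card : ℝ) * (5 / 6) ^ (k - 1)
          ≤ Real.exp ((k - 1 : ℕ) * (1 / 250)) * (5 / 6) ^ (k - 1) := by
            gcongr
            exact (card_signNet_le ht htN).trans (Real.exp_le_exp.2 hexp)
        _ = (Real.exp (1 / 250) * (5 / 6)) ^ (k - 1) := by rw [Real.exp_nat_mul, mul_pow]
        _ < Real.exp (-(1 / 96)) ^ (k - 1) := pow_lt_pow_left₀ h1 (by positivity) hm.ne'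
        _ = Real.exp (-((k - 1 : ℕ) / 96)) := by
            rw [← Real.exp_nat_mul]
            ring_nf)
  refine ⟨A, fun x hx => ?_⟩
  have h1 := sum_sq_le_of_signSum_eq_zero hm ht hA hx
  have h2 : 1 / (2 * t : ℝ) ≤ 1000 * (L ^ 3 / k) := by
    have : 1000 * (L ^ 3 / k) = 1 / u := by
      rw [hu]
      field_simp
    rw [this]
    gcongr
    linarith
  calc ∑ i, x i ^ 2 ≤ 200 * (∑ i, |x i|) ^ 2 / t := by
        rw [le_div_iff₀ (by linarith)]
        linarith
    _ = 400 * (1 / (2 * t)) * (∑ i, |x i|) ^ 2 := by field_simp; ring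
    _ ≤ 400 * (1000 * (L ^ 3 / k)) * (∑ i, |x i|) ^ 2 := by gcongr
    _ = _ := by ring

lemma kolmogorovNumber_nonneg {X Y : Type*} [NormedAddCommGroup X] [NormedSpace ℂ X]
    [NormedAddCommGroup Y] [NormedSpace ℂ Y] (T : X →L[ℂ] Y) (k : ℕ) :
    0 ≤ kolmogorovNumber T k := by
  refine Real.sInf_nonneg ?_
  rintro r ⟨L, -, rfl⟩
  exact Real.iSup_nonneg fun x => Real.iInf_nonneg fun z => norm_nonneg _

lemma kolmogorovNumber_le {X Y : Type*} [NormedAddCommGroup X] [NormedSpace ℂ X]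
    [NormedAddCommGroup Y] [NormedSpace ℂ Y] {T : X →L[ℂ] Y} {k : ℕ} {c : ℝ} (hc : 0 ≤ c)
    (L : Submodule ℂ Y) (hL : Module.rank ℂ L < (k : Cardinal))
    (h : ∀ x, ‖x‖ ≤ 1 → Metric.infDist (T x) (L : Set Y) ≤ c) :
    kolmogorovNumber T k ≤ c := by
  refine le_trans (csInf_le ⟨0, ?_⟩ ⟨L, hL, rfl⟩) (Real.iSup_le (fun x => ?_) hc)
  · rintro r ⟨L, -, rfl⟩
    exact Real.iSup_nonneg fun x => Real.iInf_nonneg fun z => norm_nonneg _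
  · have := h x.1 x.2
    simp only [Metric.infDist_eq_iInf, dist_eq_norm] at this
    exact this

/-- The distance to a subspace is attained by a functional of norm at most one annihilating it. -/
lemma exists_dual_infDist {Y : Type*} [NormedAddCommGroup Y] [NormedSpace ℂ Y]
    (L : Submodule ℂ Y) (y : Y) :
    ∃ f : Y →ₗ[ℂ] ℂ, (∀ v, ‖f v‖ ≤ ‖v‖) ∧ (∀ z ∈ L, f z = 0) ∧
      f y = (Metric.infDist y (L : Set Y) : ℝ) := by
  obtain ⟨g, hg, hgy⟩ := exists_dual_vector'' ℂ (L.mkQ y)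
  refine ⟨g.toLinearMap ∘ₗ L.mkQ, fun v => ?_, fun z hz => ?_, ?_⟩
  · calc ‖g (L.mkQ v)‖ ≤ 1 * ‖L.mkQ v‖ := g.le_of_opNorm_le hg _
      _ ≤ ‖v‖ := by rw [one_mul]; exact Submodule.Quotient.norm_mk_le (S := L) v
  · have : L.mkQ z = 0 := (Submodule.Quotient.mk_eq_zero L).2 hz
    simp [this]
  · have h : ‖L.mkQ y‖ = Metric.infDist y (L : Set Y) :=
      QuotientAddGroup.norm_mk (S := L.toAddSubgroup) y
    rw [← h]
    exact hgy

lemma sum_norm_sq_le_one {p : ℝ≥0∞} [Fact (1 ≤ p)] (hp : p < 2) {N : ℕ}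
    {x : PiLp p fun _ : Fin N => ℂ} (hx : ‖x‖ ≤ 1) : ∑ i, ‖x i‖ ^ 2 ≤ 1 := by
  have hp1 : 1 ≤ p.toReal := by
    simpa using ENNReal.toReal_mono hp.ne_top (Fact.out : 1 ≤ p)
  have hp2 : p.toReal ≤ 2 := by
    simpa using ENNReal.toReal_mono (by simp) hp.le
  rw [PiLp.norm_eq_sum (by linarith)] at hx
  have h0 : 0 ≤ ∑ i, ‖x i‖ ^ p.toReal := Finset.sum_nonneg fun i _ => by positivity
  have hS : ∑ i, ‖x i‖ ^ p.toReal ≤ 1 := by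
    by_contra! h
    exact hx.not_gt (Real.one_lt_rpow h (by positivity))
  refine le_trans (Finset.sum_le_sum fun i _ => ?_) hS
  have hi : ‖x i‖ ^ p.toReal ≤ 1 := (Finset.single_le_sum
    (f := fun i => ‖x i‖ ^ p.toReal) (fun i _ => by positivity) (Finset.mem_univ i)).trans hS
  have hi1 : ‖x i‖ ≤ 1 := by
    by_contra! h
    exact hi.not_gt (Real.one_lt_rpow h (by linarith))
  rcases (norm_nonneg (x i)).eq_or_lt with h | h
  · rw [← h]
    simp only [ne_eq, OfNat.ofNat_ne_zero, not_false_eq_true, zero_pow]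
    positivity
  · rw [← Real.rpow_natCast]
    exact Real.rpow_le_rpow_of_exponent_ge h hi1 (by exact_mod_cast hp2)

lemma apply_eq_sum_single {N : ℕ} (f : PiLp ∞ (fun _ : Fin N => ℂ) →ₗ[ℂ] ℂ)
    (y : PiLp ∞ fun _ : Fin N => ℂ) :
    f y = ∑ i, y i * f (WithLp.toLp ∞ (Pi.single i 1)) := by
  have h := LinearMap.pi_apply_eq_sum_univ
    (f ∘ₗ (WithLp.linearEquiv ∞ ℂ (Fin N → ℂ)).symm.toLinearMap) (WithLp.ofLp y)
  have h1 : ∀ i : Fin N, (fun j => if i = j then (1 : ℂ) else 0) = Pi.single i 1 := fun i => by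
    ext j
    simp [Pi.single_apply, eq_comm]
  simpa [h1] using h

lemma sum_norm_apply_single_le_one {N : ℕ} {f : PiLp ∞ (fun _ : Fin N => ℂ) →ₗ[ℂ] ℂ}
    (hf : ∀ v, ‖f v‖ ≤ ‖v‖) : ∑ i, ‖f (WithLp.toLp ∞ (Pi.single i 1))‖ ≤ 1 := by
  set a : Fin N → ℂ := fun i => f (WithLp.toLp ∞ (Pi.single i 1))
  set v : PiLp ∞ fun _ : Fin N => ℂ := WithLp.toLp ∞ fun i => star (a i) / ‖a i‖
  have hv : ‖v‖ ≤ 1 := by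
    rw [PiLp.norm_eq_ciSup]
    refine Real.iSup_le (fun i => ?_) zero_le_one
    simp only [v, norm_div, norm_star, Complex.norm_real, norm_norm]
    exact div_self_le_one _
  have hfv : f v = ((∑ i, ‖a i‖ : ℝ) : ℂ) := by
    rw [apply_eq_sum_single]
    push_cast
    refine Finset.sum_congr rfl fun i _ => ?_
    change star (a i) / ‖a i‖ * a i = ‖a i‖
    by_cases h : a i = 0
    · simp [h]
    · have h' : (‖a i‖ : ℂ) ≠ 0 := by simpa using h
      rw [div_mul_eq_mul_div, div_eq_iff h', ← sq, mul_comm]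
      exact Complex.mul_conj' (a i)
  have h := (hf v).trans hv
  rw [hfv, Complex.norm_real] at h
  exact (le_abs_self _).trans h

lemma sum_norm_sq_le_of_sum_sq_le {N m : ℕ} {A : Fin m → Fin N → Bool} {M : ℝ} (hM : 0 ≤ M)
    (hA : ∀ x : Fin N → ℝ, (∀ r, signSum (A r) x = 0) → ∑ i, x i ^ 2 ≤ M * (∑ i, |x i|) ^ 2)
    {a : Fin N → ℂ} (ha : ∀ r, ∑ i, (boolSign (A r i) : ℂ) * a i = 0) :
    ∑ i, ‖a i‖ ^ 2 ≤ 2 * M * (∑ i, ‖a i‖) ^ 2 := by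
  have hre := hA (fun i => (a i).re) fun r => by
    simpa [signSum_apply] using congrArg Complex.re (ha r)
  have him := hA (fun i => (a i).im) fun r => by
    simpa [signSum_apply] using congrArg Complex.im (ha r)
  have hre' : (∑ i, |(a i).re|) ^ 2 ≤ (∑ i, ‖a i‖) ^ 2 := by
    gcongr with i
    exact Complex.abs_re_le_norm _
  have him' : (∑ i, |(a i).im|) ^ 2 ≤ (∑ i, ‖a i‖) ^ 2 := by
    gcongr with i
    exact Complex.abs_im_le_norm _
  have h : ∑ i, ‖a i‖ ^ 2 = ∑ i, (a i).re ^ 2 + ∑ i, (a i).im ^ 2 := by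
    rw [← Finset.sum_add_distrib]
    refine Finset.sum_congr rfl fun i _ => ?_
    rw [Complex.sq_norm, Complex.normSq_apply]
    ring
  rw [h]
  nlinarith [mul_le_mul_of_nonneg_left hre' hM, mul_le_mul_of_nonneg_left him' hM]

lemma lpId_apply (p₁ p₂ : ℝ≥0∞) [Fact (1 ≤ p₁)] [Fact (1 ≤ p₂)] {N : ℕ}
    (x : PiLp p₁ fun _ : Fin N => ℂ) (i : Fin N) : lpId p₁ p₂ N x i = x i := rfl

lemma kolmogorovNumber_lpId_le_one (p : ℝ≥0∞) [Fact (1 ≤ p)] {N k : ℕ} (hk : 1 ≤ k) :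
    kolmogorovNumber (lpId p ∞ N) k ≤ 1 := by
  refine kolmogorovNumber_le zero_le_one ⊥ ?_ fun x hx => ?_
  · rw [rank_bot]
    exact_mod_cast hk
  · refine (Metric.infDist_le_dist_of_mem (Submodule.zero_mem ⊥)).trans ?_
    rw [dist_zero_right, PiLp.norm_eq_ciSup]
    exact Real.iSup_le (fun i => (PiLp.norm_apply_le x i).trans hx) zero_le_one

lemma kolmogorovNumber_lpId_le_of_sum_sq_le {p : ℝ≥0∞} [Fact (1 ≤ p)] (hp : p < 2) {N m : ℕ}
    {A : Fin m → Fin N → Bool} {M : ℝ} (hM : 0 ≤ M)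
    (hA : ∀ x : Fin N → ℝ, (∀ r, signSum (A r) x = 0) → ∑ i, x i ^ 2 ≤ M * (∑ i, |x i|) ^ 2) :
    kolmogorovNumber (lpId p ∞ N) (m + 1) ≤ √(2 * M) := by
  set row : Fin m → PiLp ∞ (fun _ : Fin N => ℂ) :=
    fun r => WithLp.toLp ∞ fun i => (boolSign (A r i) : ℂ)
  refine kolmogorovNumber_le (Real.sqrt_nonneg _) (Submodule.span ℂ (Set.range row)) ?_
    fun x hx => ?_
  · refine ((rank_span_le _).trans Cardinal.mk_range_le).trans_lt ?_
    rw [Cardinal.mk_fin]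
    exact_mod_cast Nat.lt_succ_self m
  · obtain ⟨f, hf, hf0, hfx⟩ :=
      exists_dual_infDist (Submodule.span ℂ (Set.range row)) (lpId p ∞ N x)
    set d := Metric.infDist (lpId p ∞ N x) (Submodule.span ℂ (Set.range row) : Set _)
    set a : Fin N → ℂ := fun i => f (WithLp.toLp ∞ (Pi.single i 1)) with ha
    have ha1 : ∑ i, ‖a i‖ ≤ 1 := sum_norm_apply_single_le_one hf
    have ha2 : ∑ i, ‖a i‖ ^ 2 ≤ 2 * M := by
      refine (sum_norm_sq_le_of_sum_sq_le hM hA fun r => ?_).trans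
        (mul_le_of_le_one_right (by positivity) (pow_le_one₀ (by positivity) ha1))
      rw [← hf0 (row r) (Submodule.subset_span ⟨r, rfl⟩), apply_eq_sum_single]
    refine Real.le_sqrt_of_sq_le ?_
    have hd : d ≤ ∑ i, ‖x i‖ * ‖a i‖ := by
      calc d = ‖f (lpId p ∞ N x)‖ := by
            rw [hfx, Complex.norm_real, Real.norm_of_nonneg Metric.infDist_nonneg]
        _ ≤ _ := by
            rw [apply_eq_sum_single]
            refine (norm_sum_le _ _).trans_eq (Finset.sum_congr rfl fun i _ => ?_)
            rw [norm_mul, lpId_apply]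
    calc d ^ 2 ≤ (∑ i, ‖x i‖ * ‖a i‖) ^ 2 :=
          pow_le_pow_left₀ Metric.infDist_nonneg hd 2
      _ ≤ (∑ i, ‖x i‖ ^ 2) * ∑ i, ‖a i‖ ^ 2 := Finset.sum_mul_sq_le_sq_mul_sq _ _ _
      _ ≤ 1 * (2 * M) := by
          gcongr
          exact sum_norm_sq_le_one hp hx
      _ = 2 * M := one_mul _

/-- If `1 ≤ p₁ < 2`, there is `C > 0` with
`d_k(id : ℓ_{p₁}^N → ℓ_∞^N) ≤ C k^{-1/2} (log(4eN/k))^{3/2}` for `k ≤ N`, and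
`d_k(id : ℓ_{p₁}^N → ℓ_∞^N) = 0` for `k > N`. -/
theorem stmt10 (p₁ : ℝ≥0∞) [Fact (1 ≤ p₁)] (hp : p₁ < 2) :
    ∃ C : ℝ, 0 < C ∧
      ∀ N k : ℕ, 1 ≤ k →
        (k ≤ N → kolmogorovNumber (lpId p₁ ∞ N) k
          ≤ C * (k : ℝ) ^ (-(1/2) : ℝ)
            * (Real.log (4 * Real.exp 1 * (N : ℝ) / (k : ℝ))) ^ ((3 : ℝ)/2)) ∧
        (N < k → kolmogorovNumber (lpId p₁ ∞ N) k = 0) := by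
  refine ⟨1000, by norm_num, fun N k hk => ⟨fun hkN => ?_, fun hNk => ?_⟩⟩
  · have hL2 := two_le_log_ratio hk hkN
    have hk' : (0 : ℝ) < k := by exact_mod_cast hk
    set L := Real.log (4 * Real.exp 1 * N / k) with hLdef
    have hR : 1000 * (k : ℝ) ^ (-(1 / 2) : ℝ) * L ^ ((3 : ℝ) / 2) = √(1000000 * (L ^ 3 / k)) := by
      rw [eq_comm, Real.sqrt_eq_iff_eq_sq (by positivity) (by positivity)]
      rw [mul_pow, mul_pow, ← Real.rpow_mul_natCast hk'.le, ← Real.rpow_mul_natCast (by linarith)]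
      norm_num
      rw [Real.rpow_neg_one]
      field_simp
    rw [hR]
    rcases le_or_gt (1000 * L ^ 3) (k : ℝ) with h | h
    · obtain ⟨A, hA⟩ := exists_sign_matrix_sum_sq_le hk hkN h
      have h1 := kolmogorovNumber_lpId_le_of_sum_sq_le hp (by positivity) hA
      rw [Nat.sub_add_cancel hk] at h1
      refine h1.trans (Real.sqrt_le_sqrt ?_)
      have : 0 ≤ L ^ 3 / k := by positivity
      linarith
    · refine (kolmogorovNumber_lpId_le_one p₁ hk).trans (Real.one_le_sqrt.2 ?_)
      rw [← mul_div_assoc, one_le_div hk']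
      have : 0 ≤ L ^ 3 := by positivity
      linarith
  · refine le_antisymm (kolmogorovNumber_le le_rfl ⊤ ?_ fun x _ => ?_)
      (kolmogorovNumber_nonneg _ _)
    · rw [rank_top, (WithLp.linearEquiv ∞ ℂ (Fin N → ℂ)).rank_eq, rank_fin_fun]
      exact_mod_cast hNk
    · exact (Metric.infDist_zero_of_mem (Submodule.mem_top)).le
end

section
/- Let 1 ≤ p₂ ≤ p₁ ≤ ∞. Then there exist a constant c with 0 < c ≤ 1 and a constant C > 0 such that for every k ∈ ℕ one has d_{⌊ck⌋+1}(id : ℓ_{p₁}^{2k} → ℓ_{p₂}^{2k}) ≥ C · k^{1/p₂ − 1/p₁} (with the convention 1/∞ = 0). -/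
open scoped ENNReal

open Finset in
/-- A subspace of `𝕜^ι` of dimension at least `n` contains a vector of sup norm at most one with at
least `n` coordinates of modulus one. -/
theorem Submodule.exists_mem_norm_le_one_card_le {𝕜 ι : Type*} [RCLike 𝕜] [Fintype ι]
    (M : Submodule 𝕜 (ι → 𝕜)) (n : ℕ) (hn : n ≤ Module.finrank 𝕜 M) :
    ∃ y ∈ M, (∀ i, ‖y i‖ ≤ 1) ∧ n ≤ #{i | ‖y i‖ = 1} := by
  induction n with
  | zero => exact ⟨0, M.zero_mem, by simp, Nat.zero_le _⟩
  | succ n ih =>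
    obtain ⟨y, hyM, hy1, hcard⟩ := ih (by omega)
    by_cases hlt : n + 1 ≤ #{i | ‖y i‖ = 1}
    · exact ⟨y, hyM, hy1, hlt⟩
    obtain ⟨z, hzM, hzJ, i₀, hi₀⟩ :
        ∃ z ∈ M, (∀ i, ‖y i‖ = 1 → z i = 0) ∧ ∃ i, z i ≠ 0 := by
      let T : M →ₗ[𝕜] ({i // ‖y i‖ = 1} → 𝕜) :=
        (LinearMap.funLeft 𝕜 𝕜 Subtype.val).comp M.subtype
      have hT : LinearMap.ker T ≠ ⊥ := by
        apply LinearMap.ker_ne_bot_of_finrank_lt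
        rw [Module.finrank_fintype_fun_eq_card, Fintype.card_subtype]
        omega
      obtain ⟨z, hz, hz0⟩ := Submodule.exists_mem_ne_zero_of_ne_bot hT
      refine ⟨z, z.2, fun i hi => congrFun (LinearMap.mem_ker.mp hz) ⟨i, hi⟩, ?_⟩
      by_contra! h
      exact hz0 (Subtype.ext (funext h))
    have hi₀J : ‖y i₀‖ ≠ 1 := fun h => hi₀ (hzJ i₀ h)
    let f : ℝ → ℝ := fun t => ‖fun i : {i // ‖y i‖ ≠ 1} => y i + (t : 𝕜) * z i‖
    have hf : Continuous f := by fun_prop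
    have hf0 : f 0 ≤ 1 := by
      refine (pi_norm_le_iff_of_nonneg zero_le_one).2 fun i => ?_
      simpa using hy1 i
    have hz₀ : 0 < ‖z i₀‖ := norm_pos_iff.2 hi₀
    have hf1 : 1 ≤ f (2 / ‖z i₀‖) := by
      have h1 := norm_le_pi_norm
        (fun i : {i // ‖y i‖ ≠ 1} => y i + ((2 / ‖z i₀‖ : ℝ) : 𝕜) * z i) ⟨i₀, hi₀J⟩
      have h2 : ‖((2 / ‖z i₀‖ : ℝ) : 𝕜) * z i₀‖ = 2 := by
        rw [norm_mul, RCLike.norm_ofReal, abs_of_pos (by positivity)]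
        field_simp
      have h3 := norm_sub_le (y i₀ + ((2 / ‖z i₀‖ : ℝ) : 𝕜) * z i₀) (y i₀)
      rw [add_sub_cancel_left, h2] at h3
      have h4 := hy1 i₀
      refine le_trans ?_ h1
      dsimp only
      linarith
    obtain ⟨t, -, ht⟩ := intermediate_value_Icc (by positivity : 0 ≤ 2 / ‖z i₀‖)
      hf.continuousOn ⟨hf0, hf1⟩
    have hle : ∀ i, ‖y i + (t : 𝕜) * z i‖ ≤ 1 := by
      intro i
      by_cases hi : ‖y i‖ = 1
      · simp [hzJ i hi, hi]
      · exact ht ▸ norm_le_pi_norm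
          (fun i : {i // ‖y i‖ ≠ 1} => y i + (t : 𝕜) * z i) ⟨i, hi⟩
    obtain ⟨i₁, hi₁J, hi₁⟩ : ∃ i, ‖y i‖ ≠ 1 ∧ ‖y i + (t : 𝕜) * z i‖ = 1 := by
      by_contra! h
      exact ht.not_lt ((pi_norm_lt_iff zero_lt_one).2 fun i => (hle i).lt_of_ne (h i i.2))
    refine ⟨y + (t : 𝕜) • z, M.add_mem hyM (M.smul_mem _ hzM), hle, ?_⟩
    refine Nat.succ_le_of_lt (hcard.trans_lt (card_lt_card ?_))
    refine (ssubset_iff_of_subset fun i hi => ?_).2 ⟨i₁, by simp [hi₁, RCLike.real_smul_eq_coe_mul], by simpa using hi₁J⟩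
    have hi' : ‖y i‖ = 1 := by simpa using hi
    simp [hzJ i hi', hi']

/-- The annihilator of a subspace of `𝕜^ι` under the dot product has complementary dimension (or
more). -/
theorem Submodule.exists_dotProduct_eq_zero_of_finrank {𝕜 ι : Type*} [Field 𝕜] [Fintype ι]
    (L : Submodule 𝕜 (ι → 𝕜)) :
    ∃ M : Submodule 𝕜 (ι → 𝕜), (∀ y ∈ M, ∀ z ∈ L, ∑ i, z i * y i = 0) ∧
      Fintype.card ι ≤ Module.finrank 𝕜 M + Module.finrank 𝕜 L := by
  let T : (ι → 𝕜) →ₗ[𝕜] Module.Dual 𝕜 L :=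
    L.subtype.dualMap.comp (dotProductBilin 𝕜 𝕜 (m := ι) (A := 𝕜))
  refine ⟨LinearMap.ker T, fun y hy z hz => ?_, ?_⟩
  · have := LinearMap.congr_fun (LinearMap.mem_ker.mp hy) ⟨z, hz⟩
    simpa [T, dotProduct, mul_comm] using this
  · have h1 := LinearMap.finrank_range_add_finrank_ker T
    have h2 := Submodule.finrank_le (LinearMap.range T)
    rw [Subspace.dual_finrank_eq] at h2
    rw [Module.finrank_fintype_fun_eq_card] at h1
    omega

theorem PiLp.sum_norm_le {ι E : Type*} [Fintype ι] [Nonempty ι] [NormedAddCommGroup E] (p : ℝ≥0∞)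
    [Fact (1 ≤ p)] (w : PiLp p (fun _ : ι => E)) :
    ∑ i, ‖w i‖ ≤ (Fintype.card ι : ℝ) ^ (1 - (p⁻¹).toReal) * ‖w‖ := by
  have hN : (0 : ℝ) < Fintype.card ι := by exact_mod_cast Fintype.card_pos
  rcases eq_or_ne p ∞ with rfl | hp
  · simpa using Finset.sum_le_card_nsmul Finset.univ _ _ fun i _ => PiLp.norm_apply_le w i
  have hp1 : 1 ≤ p.toReal := by
    simpa using ENNReal.toReal_mono hp (Fact.out : 1 ≤ p)
  have hp0 : 0 < p.toReal := by linarith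
  have h := Real.rpow_sum_le_const_mul_sum_rpow Finset.univ (fun i => ‖w i‖) hp1
  simp only [abs_norm, Finset.card_univ] at h
  have hs : 0 ≤ ∑ i, ‖w i‖ := Finset.sum_nonneg fun i _ => norm_nonneg _
  have h' := Real.rpow_le_rpow (by positivity) h (inv_nonneg.2 hp0.le)
  rw [Real.rpow_rpow_inv hs hp0.ne', Real.mul_rpow (by positivity)
    (Finset.sum_nonneg fun i _ => by positivity), ← Real.rpow_mul hN.le] at h'
  rw [PiLp.norm_eq_sum hp0, ENNReal.toReal_inv, one_div]
  convert h' using 3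
  field_simp

theorem PiLp.norm_le_card_rpow_mul {ι E : Type*} [Fintype ι] [NormedAddCommGroup E] (p : ℝ≥0∞)
    [Fact (1 ≤ p)] (x : PiLp p (fun _ : ι => E)) (J : Finset ι) {a : ℝ} (ha : 0 ≤ a)
    (hx : ∀ i ∈ J, ‖x i‖ ≤ a) (hx0 : ∀ i ∉ J, x i = 0) :
    ‖x‖ ≤ (J.card : ℝ) ^ (p⁻¹).toReal * a := by
  rcases eq_or_ne p ∞ with rfl | hp
  · rw [PiLp.norm_eq_ciSup]
    refine Real.iSup_le (fun i => ?_) (by simpa using ha)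
    by_cases hi : i ∈ J
    · simpa using hx i hi
    · simpa [hx0 i hi] using ha
  have hp1 : 1 ≤ p.toReal := by
    simpa using ENNReal.toReal_mono hp (Fact.out : 1 ≤ p)
  have hp0 : 0 < p.toReal := by linarith
  have hsum : ∑ i, ‖x i‖ ^ p.toReal ≤ J.card * a ^ p.toReal := by
    rw [← Finset.sum_subset J.subset_univ fun i _ hi => by
      rw [hx0 i hi, norm_zero, Real.zero_rpow hp0.ne'], ← nsmul_eq_mul]
    exact Finset.sum_le_card_nsmul _ _ _ fun i hi =>
      Real.rpow_le_rpow (norm_nonneg _) (hx i hi) hp0.le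
  rw [PiLp.norm_eq_sum hp0, ENNReal.toReal_inv, one_div]
  calc _ ≤ (J.card * a ^ p.toReal) ^ p.toReal⁻¹ :=
        Real.rpow_le_rpow (Finset.sum_nonneg fun i _ => by positivity) hsum (by positivity)
    _ = _ := by
        rw [Real.mul_rpow (by positivity) (by positivity), Real.rpow_rpow_inv ha hp0.ne']

/-- To bound a Kolmogorov number from below, it suffices to find for each admissible subspace a
point of the unit ball whose image is far from it. -/
theorem le_kolmogorovNumber_succ {X Y : Type*} [NormedAddCommGroup X] [NormedSpace ℂ X]
    [NormedAddCommGroup Y] [NormedSpace ℂ Y] (T : X →L[ℂ] Y) (k : ℕ) (b : ℝ)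
    (h : ∀ L : Submodule ℂ Y, Module.rank ℂ L ≤ k →
      ∃ x, ‖x‖ ≤ 1 ∧ ∀ z ∈ L, b ≤ ‖T x - z‖) :
    b ≤ kolmogorovNumber T (k + 1) := by
  refine le_csInf ⟨_, ⊥, by simp, rfl⟩ ?_
  rintro r ⟨L, hL, rfl⟩
  obtain ⟨x, hx, hxL⟩ := h L (by
    rw [← Order.lt_succ_iff]
    simpa using hL)
  refine le_ciSup_of_le ⟨‖T‖, ?_⟩ ⟨x, hx⟩ (le_ciInf fun z => hxL z z.2)
  rintro _ ⟨u, rfl⟩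
  refine (ciInf_le ⟨0, ?_⟩ (0 : L)).trans ?_
  · rintro _ ⟨z, rfl⟩
    exact norm_nonneg _
  · simpa using T.unit_le_opNorm u.1 u.2

/-- If `1 ≤ p₂ ≤ p₁ ≤ ∞`, there are `0 < c ≤ 1` and `C > 0` such that for every `k`:
`d_{⌊ck⌋+1}(id : ℓ_{p₁}^{2k} → ℓ_{p₂}^{2k}) ≥ C k^{1/p₂ - 1/p₁}` (with `1/∞ = 0`). -/
theorem stmt11 (p₁ p₂ : ℝ≥0∞) [Fact (1 ≤ p₁)] [Fact (1 ≤ p₂)] (h : p₂ ≤ p₁) :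
    ∃ c C : ℝ, 0 < c ∧ c ≤ 1 ∧ 0 < C ∧
      ∀ k : ℕ, 1 ≤ k →
        C * (k : ℝ) ^ ((p₂⁻¹).toReal - (p₁⁻¹).toReal)
          ≤ kolmogorovNumber (lpId p₁ p₂ (2 * k)) (⌊c * (k : ℝ)⌋₊ + 1) := by
  refine ⟨1, 1 / 2, one_pos, le_rfl, by norm_num, fun k hk => ?_⟩
  rw [one_mul, Nat.floor_natCast]
  refine le_kolmogorovNumber_succ _ _ _ fun L hL => ?_
  have hk0 : (0 : ℝ) < k := by exact_mod_cast hk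
  let e := WithLp.linearEquiv p₂ ℂ (Fin (2 * k) → ℂ)
  obtain ⟨M, hM, hMrank⟩ := (L.map e.toLinearMap).exists_dotProduct_eq_zero_of_finrank
  have hLrank : Module.finrank ℂ (L.map e.toLinearMap) ≤ k :=
    (LinearEquiv.finrank_map_eq e L).trans_le (Module.finrank_le_of_rank_le hL)
  rw [Fintype.card_fin] at hMrank
  obtain ⟨y, hyM, hy1, hcard⟩ := M.exists_mem_norm_le_one_card_le k (by omega)
  obtain ⟨J, hJy, hJ⟩ := Finset.exists_subset_card_eq hcard
  replace hJy : ∀ i ∈ J, ‖y i‖ = 1 := fun i hi => by simpa using hJy hi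
  let a : ℝ := (k : ℝ) ^ (-(p₁⁻¹).toReal)
  have ha : 0 ≤ a := by positivity
  let x : PiLp p₁ (fun _ : Fin (2 * k) => ℂ) :=
    WithLp.toLp p₁ fun i => if i ∈ J then (a : ℂ) * starRingEnd ℂ (y i) else 0
  refine ⟨x, ?_, fun z hz => ?_⟩
  · refine (PiLp.norm_le_card_rpow_mul p₁ x J ha (fun i hi => ?_) fun i hi => ?_).trans_eq ?_
    · simp [x, hi, hJy i hi, abs_of_nonneg ha]
    · simp [x, hi]
    · rw [hJ, ← Real.rpow_add hk0, add_neg_cancel, Real.rpow_zero]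
  have hxy : ∑ i, x i * y i = ((k * a : ℝ) : ℂ) := by
    calc ∑ i, x i * y i = ∑ i, if i ∈ J then (a : ℂ) else 0 := by
          refine Finset.sum_congr rfl fun i _ => ?_
          by_cases hi : i ∈ J
          · simp [x, hi, mul_assoc, Complex.conj_mul', hJy i hi]
          · simp [x, hi]
      _ = _ := by simp [hJ]
  have hzy : ∑ i, z i * y i = 0 := hM y hyM (e z) (Submodule.mem_map_of_mem hz)
  have hNe : Nonempty (Fin (2 * k)) := ⟨⟨0, by omega⟩⟩
  set w := lpId p₁ p₂ (2 * k) x - z with hw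
  have hwi : ∀ i, w i = x i - z i := fun i => rfl
  have hle : k * a ≤ (2 * k : ℝ) ^ (1 - (p₂⁻¹).toReal) * ‖w‖ := by
    calc k * a = ‖∑ i, w i * y i‖ := by
          simp_rw [hwi, sub_mul, Finset.sum_sub_distrib, hxy, hzy]
          rw [sub_zero, Complex.norm_real, Real.norm_of_nonneg (by positivity)]
      _ ≤ ∑ i, ‖w i‖ := (norm_sum_le _ _).trans (Finset.sum_le_sum fun i _ => by
          rw [norm_mul]
          exact mul_le_of_le_one_right (norm_nonneg _) (hy1 i))
      _ ≤ _ := by simpa using PiLp.sum_norm_le p₂ w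
  have h2 : (2 : ℝ) ^ (1 - (p₂⁻¹).toReal) ≤ 2 := by
    simpa using Real.rpow_le_rpow_of_exponent_le one_le_two
      (sub_le_self 1 (ENNReal.toReal_nonneg (a := p₂⁻¹)))
  rw [Real.mul_rpow zero_le_two hk0.le] at hle
  have hq : (0 : ℝ) < (k : ℝ) ^ (1 - (p₂⁻¹).toReal) := by positivity
  have hsplit : k * a =
      (k : ℝ) ^ (1 - (p₂⁻¹).toReal) * (k : ℝ) ^ ((p₂⁻¹).toReal - (p₁⁻¹).toReal) := by
    rw [← Real.rpow_add hk0, sub_add_sub_cancel, sub_eq_add_neg, Real.rpow_add hk0, Real.rpow_one]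
  rw [hsplit, mul_comm ((2 : ℝ) ^ _), mul_assoc] at hle
  have h3 := le_of_mul_le_mul_left hle hq
  have h4 := mul_le_mul_of_nonneg_right h2 (norm_nonneg w)
  linarith
end

section
/- Let 1 < p₁ < p₂ ≤ 2 and set θ₁ = (1/p₂′ − 1/p₁′)/(1/2 − 1/p₁′). Then there exist constants c₂ ≥ c₁ > 0, depending only on p₁ and p₂, such that for every N ∈ ℕ and every k ∈ ℕ with k ≤ N one has c₁ · ξ^{θ₁} ≤ c_k(id : ℓ_{p₁}^N → ℓ_{p₂}^N) ≤ c₂ · ξ^{θ₁}, where ξ = min(1, N^{1/p₁′} k^{−1/2}). -/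
open scoped ENNReal

/-- The `k`-th Gelfand number of a continuous linear operator `T : X → Y`. -/
noncomputable def gelfandNumber {X Y : Type*} [NormedAddCommGroup X] [NormedSpace ℂ X]
    [NormedAddCommGroup Y] [NormedSpace ℂ Y] (T : X →L[ℂ] Y) (k : ℕ) : ℝ :=
  sInf { r | ∃ M : Submodule ℂ X, IsClosed (M : Set X) ∧
    Module.rank ℂ (X ⧸ M) < (k : Cardinal) ∧
    r = ⨆ x : {x : M // ‖(x : X)‖ ≤ 1}, ‖T (x : X)‖ }

/-- The conjugate exponent `p′` of `p ∈ [1, ∞]`, characterized by `1/p + 1/p′ = 1`. -/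
noncomputable def conjExp (p : ℝ≥0∞) : ℝ≥0∞ := (1 - p⁻¹)⁻¹

/-- The signed sum `∑ j, ± x j`. -/
def signedSum {N : ℕ} (e : Fin N → Bool) (x : Fin N → ℝ) : ℝ := ∑ j, boolSign (e j) * x j

lemma sum_signs_succ {N : ℕ} (f : (Fin (N + 1) → Bool) → ℝ) :
    ∑ e, f e = ∑ e : Fin N → Bool, (f (Fin.cons true e) + f (Fin.cons false e)) := by
  rw [← (Fin.consEquiv (fun _ : Fin (N + 1) => Bool)).sum_comp, Fintype.sum_prod_type]
  simp [Fin.consEquiv, Finset.sum_add_distrib]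

lemma signedSum_cons {N : ℕ} (b : Bool) (e : Fin N → Bool) (x : Fin (N + 1) → ℝ) :
    signedSum (Fin.cons b e : Fin (N + 1) → Bool) x
      = boolSign b * x 0 + signedSum e (fun j => x j.succ) := by
  simp [signedSum, Fin.sum_univ_succ]

lemma sum_signedSum_sq {N : ℕ} (x : Fin N → ℝ) :
    ∑ e, signedSum e x ^ 2 = 2 ^ N * ∑ j, x j ^ 2 := by
  induction N with
  | zero => simp [signedSum]
  | succ N ih =>
    rw [sum_signs_succ, Fin.sum_univ_succ]
    have h := ih (fun j => x j.succ)
    have : ∀ e : Fin N → Bool, signedSum (Fin.cons true e : Fin (N + 1) → Bool) x ^ 2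
        + signedSum (Fin.cons false e : Fin (N + 1) → Bool) x ^ 2
        = 2 * x 0 ^ 2 + 2 * signedSum e (fun j => x j.succ) ^ 2 := fun e => by
      simp only [signedSum_cons, boolSign]; simp; ring
    simp only [this, Finset.sum_add_distrib, ← Finset.mul_sum, h]
    simp; ring

lemma sum_signedSum_pow_four_le {N : ℕ} (x : Fin N → ℝ) :
    ∑ e, signedSum e x ^ 4 ≤ 2 ^ N * (3 * (∑ j, x j ^ 2) ^ 2) := by
  induction N with
  | zero => simp [signedSum]
  | succ N ih =>
    rw [sum_signs_succ, Fin.sum_univ_succ]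
    have h := ih (fun j => x j.succ)
    have : ∀ e : Fin N → Bool, signedSum (Fin.cons true e : Fin (N + 1) → Bool) x ^ 4
        + signedSum (Fin.cons false e : Fin (N + 1) → Bool) x ^ 4
        = 2 * x 0 ^ 4 + 12 * x 0 ^ 2 * signedSum e (fun j => x j.succ) ^ 2
          + 2 * signedSum e (fun j => x j.succ) ^ 4 := fun e => by
      simp only [signedSum_cons, boolSign]; simp; ring
    simp only [this, Finset.sum_add_distrib, ← Finset.mul_sum, sum_signedSum_sq]
    have h4 : (0 : ℝ) ≤ 2 ^ N * x 0 ^ 4 := by positivity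
    simp only [Finset.sum_const, Finset.card_univ, Fintype.card_pi, Fintype.card_bool,
      Finset.prod_const, Fintype.card_fin, nsmul_eq_mul, Nat.cast_pow, Nat.cast_ofNat]
    rw [pow_succ (2 : ℝ) N]
    nlinarith

lemma sum_exp_signedSum_le {N : ℕ} (x : Fin N → ℝ) (u : ℝ) :
    ∑ e, Real.exp (u * signedSum e x) ≤ 2 ^ N * Real.exp (u ^ 2 / 2 * ∑ j, x j ^ 2) := by
  have h1 : ∀ e : Fin N → Bool, Real.exp (u * signedSum e x)
      = ∏ j, Real.exp (u * (boolSign (e j) * x j)) := fun e => by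
    rw [← Real.exp_sum, signedSum, Finset.mul_sum]
  have h2 := Finset.prod_univ_sum (fun _ : Fin N => (Finset.univ : Finset Bool))
    (fun j b => Real.exp (u * (boolSign b * x j)))
  rw [Fintype.piFinset_univ] at h2
  simp only [h1, ← h2]
  calc ∏ j, ∑ b, Real.exp (u * (boolSign b * x j))
      ≤ ∏ j, (2 * Real.exp (u ^ 2 / 2 * x j ^ 2)) := by
        refine Finset.prod_le_prod (fun j _ => Finset.sum_nonneg fun b _ => (Real.exp_pos _).le)
          fun j _ => ?_
        have := Real.cosh_le_exp_half_sq (u * x j)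
        rw [Real.cosh_eq] at this
        simp only [Fintype.sum_bool, boolSign]
        simp only [if_true, one_mul, Bool.false_eq_true, if_false, neg_one_mul, mul_neg]
        have e1 : u ^ 2 / 2 * x j ^ 2 = (u * x j) ^ 2 / 2 := by ring
        rw [e1]; linarith
    _ = _ := by
        rw [Finset.prod_mul_distrib, ← Real.exp_sum, ← Finset.mul_sum]; simp

lemma integral_exp_neg_sq_add_mul (z : ℝ) :
    ∫ u : ℝ, Real.exp (-1 * u ^ 2 + u * z) = √Real.pi * Real.exp (z ^ 2 / 4) := by
  have h : ∀ u : ℝ, Real.exp (-1 * u ^ 2 + u * z)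
      = Real.exp (-1 * (u - z / 2) ^ 2) * Real.exp (z ^ 2 / 4) := fun u => by
    rw [← Real.exp_add]; congr 1; ring
  simp only [h]
  rw [MeasureTheory.integral_mul_const,
    MeasureTheory.integral_sub_right_eq_self (fun u : ℝ => Real.exp (-1 * u ^ 2)),
    integral_gaussian]
  simp

lemma integrable_exp_neg_sq_add_mul (z : ℝ) :
    MeasureTheory.Integrable fun u : ℝ => Real.exp (-1 * u ^ 2 + u * z) := by
  have h : ∀ u : ℝ, Real.exp (-1 * u ^ 2 + u * z)
      = Real.exp (-1 * (u - z / 2) ^ 2) * Real.exp (z ^ 2 / 4) := fun u => by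
    rw [← Real.exp_add]; congr 1; ring
  simp only [h]
  exact ((integrable_exp_neg_mul_sq one_pos).comp_sub_right (z / 2)).mul_const _

lemma sum_exp_sq_signedSum_le {N : ℕ} (x : Fin N → ℝ) (hx : ∑ j, x j ^ 2 ≤ 1) :
    ∑ e, Real.exp (signedSum e x ^ 2 / 4) ≤ 2 ^ N * 2 := by
  have hpi : 0 < √Real.pi := Real.sqrt_pos.2 Real.pi_pos
  have key : √Real.pi * ∑ e, Real.exp (signedSum e x ^ 2 / 4) ≤ √Real.pi * (2 ^ N * √2) := by
    calc √Real.pi * ∑ e, Real.exp (signedSum e x ^ 2 / 4)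
        = ∫ u : ℝ, ∑ e, Real.exp (-1 * u ^ 2 + u * signedSum e x) := by
          rw [MeasureTheory.integral_finsetSum _ fun e _ => integrable_exp_neg_sq_add_mul _,
            Finset.mul_sum]
          simp only [integral_exp_neg_sq_add_mul]
      _ ≤ ∫ u : ℝ, 2 ^ N * Real.exp (-(1 / 2) * u ^ 2) := by
          refine MeasureTheory.integral_mono
            (MeasureTheory.integrable_finsetSum _ fun e _ => integrable_exp_neg_sq_add_mul _)
            ((integrable_exp_neg_mul_sq (by norm_num)).const_mul _) fun u => ?_
          simp only [Real.exp_add, ← Finset.mul_sum]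
          calc Real.exp (-1 * u ^ 2) * ∑ e, Real.exp (u * signedSum e x)
              ≤ Real.exp (-1 * u ^ 2) * (2 ^ N * Real.exp (u ^ 2 / 2 * ∑ j, x j ^ 2)) := by
                gcongr; exact sum_exp_signedSum_le x u
            _ ≤ Real.exp (-1 * u ^ 2) * (2 ^ N * Real.exp (u ^ 2 / 2 * 1)) := by gcongr
            _ = 2 ^ N * Real.exp (-(1 / 2) * u ^ 2) := by
                rw [mul_left_comm, ← Real.exp_add]; ring_nf
      _ = √Real.pi * (2 ^ N * √2) := by
          rw [MeasureTheory.integral_const_mul, integral_gaussian,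
            show Real.pi / (1 / 2) = Real.pi * 2 by ring, Real.sqrt_mul Real.pi_pos.le]
          ring
  refine (le_of_mul_le_mul_left key hpi).trans ?_
  gcongr
  rw [Real.sqrt_le_left (by norm_num)]; norm_num

lemma exp_neg_le_of_nonneg {y : ℝ} (hy : 0 ≤ y) : Real.exp (-y) ≤ 1 - y + y ^ 2 / 2 := by
  have h := Real.quadratic_le_exp_of_nonneg hy
  have h1 : 0 < 1 - y + y ^ 2 / 2 := by nlinarith [sq_nonneg (y - 1)]
  rw [Real.exp_neg, inv_le_comm₀ (Real.exp_pos y) h1]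
  refine le_trans ?_ h
  rw [inv_le_iff_one_le_mul₀ h1]
  nlinarith [sq_nonneg (y ^ 2)]

lemma sum_exp_neg_sq_signedSum_le {N : ℕ} (x : Fin N → ℝ) (hx : 0 < ∑ j, x j ^ 2) :
    ∑ e, Real.exp (-(signedSum e x ^ 2 / (3 * ∑ j, x j ^ 2))) ≤ 2 ^ N * (5 / 6) := by
  set A := ∑ j, x j ^ 2
  calc ∑ e, Real.exp (-(signedSum e x ^ 2 / (3 * A)))
      ≤ ∑ e, (1 - (1 / (3 * A)) * signedSum e x ^ 2
          + (1 / (18 * A ^ 2)) * signedSum e x ^ 4) := by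
        refine Finset.sum_le_sum fun e _ => ?_
        refine (exp_neg_le_of_nonneg (by positivity)).trans (le_of_eq ?_)
        field_simp; ring
    _ ≤ 2 ^ N - (1 / (3 * A)) * (2 ^ N * A) + (1 / (18 * A ^ 2)) * (2 ^ N * (3 * A ^ 2)) := by
        rw [Finset.sum_add_distrib, Finset.sum_sub_distrib, ← Finset.mul_sum, ← Finset.mul_sum,
          sum_signedSum_sq]
        have := sum_signedSum_pow_four_le x
        have h0 : (0 : ℝ) ≤ 1 / (18 * A ^ 2) := by positivity
        have := mul_le_mul_of_nonneg_left this h0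
        simp only [Finset.sum_const, Finset.card_univ]
        simp only [Fintype.card_pi, Fintype.card_bool, Finset.prod_const, Finset.card_univ,
          Fintype.card_fin, nsmul_eq_mul, mul_one, Nat.cast_pow, Nat.cast_ofNat]
        linarith
    _ = 2 ^ N * (5 / 6) := by field_simp; norm_num

/-- The Euclidean norm squared of the image of `x` under the sign matrix `G`. -/
def signMatrixSq {m N : ℕ} (G : Fin m → Fin N → Bool) (x : Fin N → ℝ) : ℝ :=
  ∑ i, signedSum (G i) x ^ 2

lemma sum_exp_signMatrixSq_le {m N : ℕ} (x : Fin N → ℝ) {T : ℝ} (hT : 0 < T)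
    (hx : ∑ j, x j ^ 2 ≤ T) :
    ∑ G : Fin m → Fin N → Bool, Real.exp (signMatrixSq G x / (4 * T)) ≤ (2 ^ N * 2) ^ m := by
  have h1 : ∀ e : Fin N → Bool, signedSum e (fun j => x j / √T) ^ 2 / 4
      = signedSum e x ^ 2 / (4 * T) := fun e => by
    have : signedSum e (fun j => x j / √T) = signedSum e x / √T := by
      simp [signedSum, Finset.sum_div, mul_div_assoc]
    rw [this, div_pow, Real.sq_sqrt hT.le]; field_simp
  have h2 := sum_exp_sq_signedSum_le (fun j => x j / √T) (by
    simp only [div_pow, Real.sq_sqrt hT.le, ← Finset.sum_div]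
    exact (div_le_one hT).2 hx)
  simp only [h1] at h2
  calc _ = (∑ e : Fin N → Bool, Real.exp (signedSum e x ^ 2 / (4 * T))) ^ m := by
        rw [Fintype.sum_pow]
        simp only [signMatrixSq, ← Real.exp_sum, Finset.sum_div]
    _ ≤ _ := by gcongr

lemma sum_exp_neg_signMatrixSq_le {m N : ℕ} (x : Fin N → ℝ) (hx : 0 < ∑ j, x j ^ 2) :
    ∑ G : Fin m → Fin N → Bool, Real.exp (-(signMatrixSq G x / (3 * ∑ j, x j ^ 2)))
      ≤ (2 ^ N * (5 / 6)) ^ m := by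
  calc _ = (∑ e : Fin N → Bool, Real.exp (-(signedSum e x ^ 2 / (3 * ∑ j, x j ^ 2)))) ^ m := by
        rw [Fintype.sum_pow]
        simp only [signMatrixSq, ← Real.exp_sum, Finset.sum_div, Finset.sum_neg_distrib]
    _ ≤ _ := by
        gcongr
        exact sum_exp_neg_sq_signedSum_le x hx

/-- The integer points of the `ℓ₁` ball of radius `T`. -/
noncomputable def intBall (N : ℕ) (T : ℝ) : Finset (Fin N → ℤ) :=
  (Fintype.piFinset fun _ => Finset.Icc (-(N : ℤ)) N).filter fun n => ∑ j, |(n j : ℝ)| ≤ T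

lemma mem_intBall {N : ℕ} {T : ℝ} (hT : T ≤ N) (n : Fin N → ℤ) :
    n ∈ intBall N T ↔ ∑ j, |(n j : ℝ)| ≤ T := by
  refine ⟨fun h => (Finset.mem_filter.1 h).2, fun h => Finset.mem_filter.2 ⟨?_, h⟩⟩
  refine Fintype.mem_piFinset.2 fun j => Finset.mem_Icc.2 (abs_le.1 ?_)
  have h1 := Finset.single_le_sum (fun j _ => abs_nonneg (n j : ℝ)) (Finset.mem_univ j)
  have h2 : |(n j : ℝ)| ≤ N := h1.trans (h.trans hT)
  exact_mod_cast h2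

lemma sum_Icc_rpow_neg_abs_le (N : ℕ) {w : ℝ} (hw : 0 < w) :
    ∑ k ∈ Finset.Icc (-(N : ℤ)) N, (1 + w) ^ (-|(k : ℝ)|) ≤ 1 + 2 / w := by
  rw [Finset.sum_Icc_of_even_eq_range (fun k => by simp)]
  have hq : (1 + w)⁻¹ < 1 := inv_lt_one_of_one_lt₀ (by linarith)
  have hq0 : 0 ≤ (1 + w)⁻¹ := by positivity
  have h : ∑ m ∈ Finset.range (N + 1), (1 + w) ^ (-|(((m : ℕ) : ℤ) : ℝ)|) ≤ 1 + 1 / w := by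
    calc _ = ∑ m ∈ Finset.range (N + 1), (1 + w)⁻¹ ^ m := by
          refine Finset.sum_congr rfl fun m _ => ?_
          rw [Int.cast_natCast, Nat.abs_cast, Real.rpow_neg (by positivity), Real.rpow_natCast,
            inv_pow]
      _ ≤ ∑' m : ℕ, (1 + w)⁻¹ ^ m :=
          (summable_geometric_of_lt_one hq0 hq).sum_le_tsum _ fun _ _ => by positivity
      _ = 1 + 1 / w := by
          have h1 : 1 - (1 + w)⁻¹ = w / (1 + w) := by field_simp; ring
          rw [tsum_geometric_of_lt_one hq0 hq, h1]; field_simp; ring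
  simp only [two_smul, Int.cast_zero, abs_zero, neg_zero, Real.rpow_zero]
  have : 2 / w = 1 / w + 1 / w := by ring
  linarith

lemma card_intBall_le (N : ℕ) (T : ℝ) {w : ℝ} (hw : 0 < w) :
    ((intBall N T).card : ℝ) ≤ Real.exp (T * Real.log (1 + w) + 2 * N / w) := by
  have hw1 : 0 < 1 + w := by positivity
  calc ((intBall N T).card : ℝ) = ∑ n ∈ intBall N T, 1 := by simp
    _ ≤ ∑ n ∈ intBall N T, (1 + w) ^ T * ∏ j, (1 + w) ^ (-|(n j : ℝ)|) := by
        refine Finset.sum_le_sum fun n hn => ?_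
        rw [← Real.rpow_sum_of_pos hw1, ← Real.rpow_add hw1, Finset.sum_neg_distrib]
        refine Real.one_le_rpow (by linarith) ?_
        have := (Finset.mem_filter.1 hn).2
        linarith
    _ ≤ ∑ n ∈ Fintype.piFinset fun _ : Fin N => Finset.Icc (-(N : ℤ)) N,
          (1 + w) ^ T * ∏ j, (1 + w) ^ (-|(n j : ℝ)|) :=
        Finset.sum_le_sum_of_subset_of_nonneg (Finset.filter_subset _ _) fun _ _ _ => by positivity
    _ = (1 + w) ^ T * (∑ k ∈ Finset.Icc (-(N : ℤ)) N, (1 + w) ^ (-|(k : ℝ)|)) ^ N := by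
        have h := Finset.prod_univ_sum (fun _ : Fin N => Finset.Icc (-(N : ℤ)) N)
          (fun _ k => (1 + w) ^ (-|(k : ℝ)|))
        rw [← Finset.mul_sum, ← h]
        simp
    _ ≤ (1 + w) ^ T * (1 + 2 / w) ^ N := by
        gcongr
        exact sum_Icc_rpow_neg_abs_le N hw
    _ ≤ (1 + w) ^ T * Real.exp (2 / w) ^ N := by
        gcongr
        linarith [Real.add_one_le_exp (2 / w)]
    _ = _ := by
        rw [Real.rpow_def_of_pos hw1, ← Real.exp_nat_mul, ← Real.exp_add]
        congr 1; ring

lemma card_intBall_rpow_le (N : ℕ) {p r y : ℝ} (hr : 0 < r) (hrp : r < p) (hy : 1 ≤ y) :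
    ((intBall N (N * y ^ (-p))).card : ℝ) ≤ Real.exp ((3 + r / (p - r)) * (N * y ^ (-r))) := by
  have hy0 : 0 < y := by linarith
  refine (card_intBall_le N _ (w := y ^ r) (by positivity)).trans (Real.exp_le_exp.2 ?_)
  have hd : 0 < p - r := by linarith
  have h1 : Real.log (1 + y ^ r) ≤ (1 + r / (p - r)) * y ^ (p - r) := by
    have hyr : 1 ≤ y ^ r := Real.one_le_rpow hy hr.le
    have hyd : 1 ≤ y ^ (p - r) := Real.one_le_rpow hy hd.le
    have h2 : Real.log (1 + y ^ r) ≤ Real.log 2 + r * Real.log y := by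
      rw [← Real.log_rpow hy0, ← Real.log_mul (by norm_num) (by positivity)]
      exact Real.log_le_log (by positivity) (by linarith)
    have h3 := Real.log_le_rpow_div hy0.le hd
    have h4 : r * Real.log y ≤ r * (y ^ (p - r) / (p - r)) := by gcongr
    have h5 : r * (y ^ (p - r) / (p - r)) = r / (p - r) * y ^ (p - r) := by ring
    linarith [Real.log_two_lt_d9]
  have h2 : y ^ (-p) * y ^ (p - r) = y ^ (-r) := by rw [← Real.rpow_add hy0]; ring_nf
  calc N * y ^ (-p) * Real.log (1 + y ^ r) + 2 * N / y ^ r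
      ≤ N * y ^ (-p) * ((1 + r / (p - r)) * y ^ (p - r)) + 2 * N / y ^ r := by gcongr
    _ = N * (1 + r / (p - r)) * (y ^ (-p) * y ^ (p - r)) + 2 * N * y ^ (-r) := by
        rw [Real.rpow_neg hy0.le r]; ring
    _ = _ := by rw [h2]; ring

lemma exists_two_pow_rpow_near {r x : ℝ} (hr : 0 < r) (hx : 1 ≤ x) :
    ∃ I : ℕ, x ≤ ((2 : ℝ) ^ I) ^ r ∧ ((2 : ℝ) ^ I) ^ r ≤ 2 ^ r * x := by
  obtain ⟨n, h1, h2⟩ := exists_nat_pow_near hx (Real.one_lt_rpow one_lt_two hr)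
  have h : ((2 : ℝ) ^ (n + 1)) ^ r = (2 ^ r) ^ (n + 1) := by
    rw [← Real.rpow_natCast, ← Real.rpow_natCast, ← Real.rpow_mul (by norm_num),
      ← Real.rpow_mul (by norm_num), mul_comm]
  refine ⟨n + 1, h ▸ h2.le, ?_⟩
  rw [h, pow_succ, mul_comm]
  gcongr

lemma sum_sum_exp_signMatrixSq_le {m N : ℕ} (S : Finset (Fin N → ℤ)) {T c C : ℝ} (hT : 0 < T)
    (hS : ∀ n ∈ S, ∑ j, (n j : ℝ) ^ 2 ≤ T) (hcard : (S.card : ℝ) ≤ Real.exp c) :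
    ∑ G : Fin m → Fin N → Bool, ∑ n ∈ S,
        Real.exp (signMatrixSq G (fun j => (n j : ℝ)) / (4 * T) - C)
      ≤ (2 ^ N) ^ m * Real.exp (c + m - C) := by
  rw [Finset.sum_comm]
  have h2 : (2 : ℝ) ^ m ≤ Real.exp m := by
    rw [← Real.exp_one_pow]
    gcongr
    linarith [Real.exp_one_gt_d9]
  calc _ ≤ ∑ n ∈ S, (2 ^ N * 2) ^ m * Real.exp (-C) := by
        refine Finset.sum_le_sum fun n hn => ?_
        simp only [sub_eq_add_neg, Real.exp_add, ← Finset.sum_mul]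
        gcongr
        exact sum_exp_signMatrixSq_le _ hT (hS n hn)
    _ = S.card * ((2 ^ N) ^ m * 2 ^ m * Real.exp (-C)) := by
        rw [Finset.sum_const, nsmul_eq_mul, mul_pow]
    _ ≤ Real.exp c * ((2 ^ N) ^ m * Real.exp m * Real.exp (-C)) := by gcongr
    _ = _ := by rw [sub_eq_add_neg, Real.exp_add, Real.exp_add]; ring

lemma sum_sum_exp_neg_signMatrixSq_le {m N : ℕ} (S : Finset (Fin N → ℤ)) {c : ℝ}
    (hS : ∀ n ∈ S, 0 < ∑ j, (n j : ℝ) ^ 2) (hcard : (S.card : ℝ) ≤ Real.exp c) :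
    ∑ G : Fin m → Fin N → Bool, ∑ n ∈ S,
        Real.exp (-(signMatrixSq G (fun j => (n j : ℝ)) / (3 * ∑ j, (n j : ℝ) ^ 2)) + m / 12)
      ≤ (2 ^ N) ^ m * Real.exp (c - m / 12) := by
  rw [Finset.sum_comm]
  have h2 : (5 / 6 : ℝ) ^ m ≤ Real.exp (-(m / 6)) := by
    have : (5 / 6 : ℝ) ≤ Real.exp (-(1 / 6)) := by linarith [Real.add_one_le_exp (-(1 / 6 : ℝ))]
    calc (5 / 6 : ℝ) ^ m ≤ Real.exp (-(1 / 6)) ^ m := by gcongr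
      _ = _ := by rw [← Real.exp_nat_mul]; ring_nf
  calc _ ≤ ∑ n ∈ S, (2 ^ N * (5 / 6)) ^ m * Real.exp (m / 12) := by
        refine Finset.sum_le_sum fun n hn => ?_
        simp only [Real.exp_add, ← Finset.sum_mul]
        gcongr
        exact sum_exp_neg_signMatrixSq_le _ (hS n hn)
    _ = S.card * ((2 ^ N) ^ m * (5 / 6) ^ m * Real.exp (m / 12)) := by
        rw [Finset.sum_const, nsmul_eq_mul, mul_pow]
    _ ≤ Real.exp c * ((2 ^ N) ^ m * Real.exp (-(m / 6)) * Real.exp (m / 12)) := by gcongr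
    _ = _ := by
        have : c - (m : ℝ) / 12 = c + -(m / 6) + m / 12 := by ring
        rw [this, Real.exp_add, Real.exp_add]; ring

lemma sum_reflect_quarter_pow_le (I : ℕ) :
    ∑ i ∈ Finset.range (I + 1), (1 / 4 : ℝ) ^ (I - i + 1) ≤ 1 / 3 := by
  rw [← Finset.sum_range_reflect (fun i => (1 / 4 : ℝ) ^ (I - i + 1))]
  have h : ∀ j ∈ Finset.range (I + 1),
      (1 / 4 : ℝ) ^ (I - (I + 1 - 1 - j) + 1) = 1 / 4 * (1 / 4) ^ j := fun j hj => by
    have := Finset.mem_range.1 hj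
    rw [show I - (I + 1 - 1 - j) + 1 = j + 1 by omega, pow_succ, mul_comm]
  rw [Finset.sum_congr rfl h, ← Finset.mul_sum]
  have := (summable_geometric_of_lt_one (r := (1 / 4 : ℝ)) (by norm_num) (by norm_num)).sum_le_tsum
    (Finset.range (I + 1)) fun _ _ => by positivity
  rw [tsum_geometric_of_lt_one (by norm_num) (by norm_num)] at this
  norm_num at this ⊢
  linarith

lemma sum_sq_le_of_abs_le_one {N : ℕ} {n : Fin N → ℤ} (hn : ∀ j, |n j| ≤ 1) :
    ∑ j, (n j : ℝ) ^ 2 ≤ ∑ j, |(n j : ℝ)| := by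
  refine Finset.sum_le_sum fun j _ => ?_
  have h : |(n j : ℝ)| ≤ 1 := by exact_mod_cast hn j
  rw [← sq_abs]
  nlinarith [abs_nonneg (n j : ℝ)]

lemma sum_signMatrix_one (m N : ℕ) : ∑ _G : Fin m → Fin N → Bool, (1 : ℝ) = (2 ^ N) ^ m := by
  simp

lemma exists_signMatrix {p r : ℝ} (hr : 1 < r) (hrp : r < p) :
    ∃ K D : ℝ, 0 < K ∧ 0 < D ∧ ∀ N m : ℕ, 24 ≤ m → m ≤ N →
      ∃ I : ℕ, m * ((2 : ℝ) ^ I) ^ r ≤ D * N ∧ ∃ G : Fin m → Fin N → Bool,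
        (∀ i ≤ I, ∀ n : Fin N → ℤ, (∀ j, |n j| ≤ 1) →
          ∑ j, |(n j : ℝ)| ≤ N * ((2 : ℝ) ^ i) ^ (-p) →
          signMatrixSq G (fun j => (n j : ℝ))
            ≤ K * (N * ((2 : ℝ) ^ i) ^ (-p)) * (N * ((2 : ℝ) ^ i) ^ (-r))) ∧
        ∀ n : Fin N → ℤ, ∑ j, |(n j : ℝ)| ≤ N * ((2 : ℝ) ^ I) ^ (-p) →
          m * ∑ j, (n j : ℝ) ^ 2 ≤ 4 * signMatrixSq G (fun j => (n j : ℝ)) := by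
  have hr0 : 0 < r := by linarith
  have hd : 0 < p - r := by linarith
  set C₁ := 3 + r / (p - r) with hC₁
  have hC₁pos : 1 ≤ C₁ := by have : 0 < r / (p - r) := by positivity
                             linarith
  set b : ℝ := 2 ^ r with hb
  have hb2 : 2 ≤ b := by
    calc (2 : ℝ) = 2 ^ (1 : ℝ) := by simp
      _ ≤ b := Real.rpow_le_rpow_of_exponent_le (by norm_num) hr.le
  have hb0 : 0 < b := by linarith
  have hpow : ∀ i : ℕ, ((2 : ℝ) ^ i) ^ r = b ^ i := fun i => by
    rw [hb, ← Real.rpow_natCast, ← Real.rpow_natCast, ← Real.rpow_mul (by norm_num),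
      ← Real.rpow_mul (by norm_num), mul_comm]
  have hpow' : ∀ i : ℕ, ((2 : ℝ) ^ i) ^ (-r) = (b ^ i)⁻¹ := fun i => by
    rw [Real.rpow_neg (by positivity), hpow]
  set E := b * (24 * C₁) with hE
  have hE0 : 0 < E := by positivity
  refine ⟨4 * (C₁ + 2 * E), E, by positivity, hE0, fun N m hm hmN => ?_⟩
  have hm0 : (24 : ℝ) ≤ m := by exact_mod_cast hm
  have hmN' : (m : ℝ) ≤ N := by exact_mod_cast hmN
  have hN0 : (0 : ℝ) < N := by linarith
  have hmpos : (0 : ℝ) < m := by linarith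
  obtain ⟨I, hI1, hI2⟩ := exists_two_pow_rpow_near hr0 (x := 24 * C₁ * N / m) (by
    rw [le_div_iff₀ hmpos]; nlinarith)
  rw [hpow] at hI1 hI2
  have hI2' : m * b ^ I ≤ E * N := by
    have := mul_le_mul_of_nonneg_left hI2 hmpos.le
    refine this.trans (le_of_eq ?_)
    rw [hE, hb]; field_simp
  have hI1' : C₁ * (N * (b ^ I)⁻¹) ≤ m / 24 := by
    rw [div_le_iff₀ hmpos] at hI1
    rw [← mul_assoc, ← div_eq_mul_inv, div_le_iff₀ (by positivity)]
    linarith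
  refine ⟨I, by rw [hpow]; exact hI2', ?_⟩
  set T : ℕ → ℝ := fun i => N * ((2 : ℝ) ^ i) ^ (-p) with hT
  have hTpos : ∀ i, 0 < T i := fun i => by positivity
  have hTN : ∀ i, T i ≤ N := fun i => by
    refine mul_le_of_le_one_right hN0.le (Real.rpow_le_one_of_one_le_of_nonpos ?_ (by linarith))
    exact one_le_pow₀ (by norm_num)
  set S : ℕ → Finset (Fin N → ℤ) := fun i => (intBall N (T i)).filter fun n => ∀ j, |n j| ≤ 1
  set S' : Finset (Fin N → ℤ) := (intBall N (T I)).filter fun n => 0 < ∑ j, (n j : ℝ) ^ 2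
  have hcard : ∀ i, ((intBall N (T i)).card : ℝ) ≤ Real.exp (C₁ * (N * (b ^ i)⁻¹)) := fun i => by
    have := card_intBall_rpow_le N hr0 hrp (y := 2 ^ i) (one_le_pow₀ (by norm_num))
    rwa [hpow'] at this
  have hS : ∀ i, ((S i).card : ℝ) ≤ Real.exp (C₁ * (N * (b ^ i)⁻¹)) := fun i =>
    le_trans (by exact_mod_cast Finset.card_filter_le _ _) (hcard i)
  have hS' : ((S' : Finset (Fin N → ℤ)).card : ℝ) ≤ Real.exp (C₁ * (N * (b ^ I)⁻¹)) :=
    le_trans (by exact_mod_cast Finset.card_filter_le _ _) (hcard I)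
  have hSsq : ∀ i, ∀ n ∈ S i, ∑ j, (n j : ℝ) ^ 2 ≤ T i := fun i n hn => by
    obtain ⟨h1, h2⟩ := Finset.mem_filter.1 hn
    exact (sum_sq_le_of_abs_le_one h2).trans ((mem_intBall (hTN i) n).1 h1)
  have hdecay : ∀ i ≤ I, m * ((I - i : ℕ) + 1 : ℝ) ≤ E * (N * (b ^ i)⁻¹) := fun i hi => by
    have h1 : ((I - i : ℕ) + 1 : ℝ) ≤ b ^ (I - i) := by
      have h2 : I - i + 1 ≤ 2 ^ (I - i) := Nat.lt_two_pow_self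
      have h3 : ((I - i : ℕ) + 1 : ℝ) ≤ 2 ^ (I - i) := by exact_mod_cast h2
      exact h3.trans (by gcongr)
    have h4 : b ^ I = b ^ (I - i) * b ^ i := by rw [← pow_add]; congr 1; omega
    rw [← mul_assoc, ← div_eq_mul_inv, le_div_iff₀ (by positivity)]
    calc m * ((I - i : ℕ) + 1 : ℝ) * b ^ i ≤ m * b ^ (I - i) * b ^ i := by gcongr
      _ = m * b ^ I := by rw [h4]; ring
      _ ≤ _ := hI2'
  set F : (Fin m → Fin N → Bool) → ℝ := fun G =>
    (∑ i ∈ Finset.range (I + 1), ∑ n ∈ S i,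
      Real.exp (signMatrixSq G (fun j => (n j : ℝ)) / (4 * T i)
        - (C₁ + 2 * E) * (N * (b ^ i)⁻¹)))
    + ∑ n ∈ S', Real.exp (-(signMatrixSq G (fun j => (n j : ℝ)) / (3 * ∑ j, (n j : ℝ) ^ 2))
        + m / 12) with hF
  have hexp1 : Real.exp (-1) ≤ 1 / 2 := by
    rw [Real.exp_neg, one_div]
    exact inv_anti₀ (by norm_num) (by linarith [Real.exp_one_gt_d9])
  have hsum : ∑ G, F G < ∑ G : Fin m → Fin N → Bool, (1 : ℝ) := by
    have h1 : ∑ G : Fin m → Fin N → Bool, (1 : ℝ) = (2 ^ N) ^ m := sum_signMatrix_one m N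
    rw [h1, hF, Finset.sum_add_distrib, Finset.sum_comm]
    have h2 : ∀ i ∈ Finset.range (I + 1), ∑ G : Fin m → Fin N → Bool, ∑ n ∈ S i,
        Real.exp (signMatrixSq G (fun j => (n j : ℝ)) / (4 * T i)
          - (C₁ + 2 * E) * (N * (b ^ i)⁻¹)) ≤ (2 ^ N) ^ m * (1 / 4) ^ (I - i + 1) := fun i hi => by
      refine (sum_sum_exp_signMatrixSq_le (S i) (hTpos i) (hSsq i) (hS i)).trans ?_
      gcongr
      have h3 := hdecay i (by have := Finset.mem_range.1 hi; omega)
      have h4 : (0 : ℝ) ≤ (I - i : ℕ) := Nat.cast_nonneg _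
      calc Real.exp (C₁ * (N * (b ^ i)⁻¹) + m - (C₁ + 2 * E) * (N * (b ^ i)⁻¹))
          ≤ Real.exp (((I - i + 1 : ℕ) : ℝ) * (-1 + -1)) := by
            refine Real.exp_le_exp.2 ?_
            push_cast
            nlinarith
        _ = (Real.exp (-1) * Real.exp (-1)) ^ (I - i + 1) := by
            rw [Real.exp_nat_mul, Real.exp_add]
        _ ≤ (1 / 2 * (1 / 2)) ^ (I - i + 1) := by gcongr
        _ = _ := by norm_num
    have h5 := sum_sum_exp_neg_signMatrixSq_le (m := m) S'
      (fun n hn => (Finset.mem_filter.1 hn).2) hS'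
    have h6 : Real.exp (C₁ * (N * (b ^ I)⁻¹) - m / 12) ≤ 1 / 2 :=
      (Real.exp_le_exp.2 (by linarith)).trans hexp1
    have h7 : (0 : ℝ) < (2 ^ N) ^ m := by positivity
    have h8 := Finset.sum_le_sum h2
    rw [← Finset.mul_sum] at h8
    have h9 := mul_le_mul_of_nonneg_left (sum_reflect_quarter_pow_le I) h7.le
    have h10 := mul_le_mul_of_nonneg_left h6 h7.le
    linarith
  obtain ⟨G, -, hG⟩ := Finset.exists_lt_of_sum_lt hsum
  have hnn1 : 0 ≤ ∑ i ∈ Finset.range (I + 1), ∑ n ∈ S i,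
      Real.exp (signMatrixSq G (fun j => (n j : ℝ)) / (4 * T i)
        - (C₁ + 2 * E) * (N * (b ^ i)⁻¹)) :=
    Finset.sum_nonneg fun _ _ => Finset.sum_nonneg fun _ _ => (Real.exp_pos _).le
  have hnn2 : 0 ≤ ∑ n ∈ S', Real.exp (-(signMatrixSq G (fun j => (n j : ℝ))
      / (3 * ∑ j, (n j : ℝ) ^ 2)) + m / 12) :=
    Finset.sum_nonneg fun _ _ => (Real.exp_pos _).le
  simp only [hF] at hG
  refine ⟨G, fun i hi n hn1 hn2 => ?_, fun n hn => ?_⟩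
  · have hmem : n ∈ S i := Finset.mem_filter.2 ⟨(mem_intBall (hTN i) n).2 hn2, hn1⟩
    have h1 := Finset.single_le_sum (f := fun n => Real.exp (signMatrixSq G (fun j => (n j : ℝ))
      / (4 * T i) - (C₁ + 2 * E) * (N * (b ^ i)⁻¹))) (fun _ _ => (Real.exp_pos _).le) hmem
    have h2 := Finset.single_le_sum (f := fun i => ∑ n ∈ S i, Real.exp
      (signMatrixSq G (fun j => (n j : ℝ)) / (4 * T i) - (C₁ + 2 * E) * (N * (b ^ i)⁻¹)))
      (fun _ _ => Finset.sum_nonneg fun _ _ => (Real.exp_pos _).le) (Finset.mem_range.2 (Nat.lt_succ_of_le hi))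
    have h3 := Real.exp_lt_one_iff.1 (lt_of_le_of_lt (h1.trans h2) (by linarith))
    rw [sub_neg, div_lt_iff₀ (by have := hTpos i; positivity)] at h3
    rw [hpow']
    refine h3.le.trans (le_of_eq ?_)
    simp only [hT]; ring
  · rcases (Finset.sum_nonneg fun j _ => sq_nonneg (n j : ℝ)).eq_or_lt with h0 | h0
    · rw [← h0, mul_zero]
      exact mul_nonneg (by norm_num) (Finset.sum_nonneg fun _ _ => sq_nonneg _)
    · have hmem : n ∈ S' := Finset.mem_filter.2 ⟨(mem_intBall (hTN I) n).2 hn, h0⟩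
      have h1 := Finset.single_le_sum (f := fun n => Real.exp (-(signMatrixSq G
        (fun j => (n j : ℝ)) / (3 * ∑ j, (n j : ℝ) ^ 2)) + m / 12))
        (fun _ _ => (Real.exp_pos _).le) hmem
      have h3 := Real.exp_lt_one_iff.1 (lt_of_le_of_lt h1 (by linarith))
      have h4 : (m : ℝ) / 12 < signMatrixSq G (fun j => (n j : ℝ)) / (3 * ∑ j, (n j : ℝ) ^ 2) := by
        linarith
      rw [lt_div_iff₀ (by positivity)] at h4
      linarith

/-- The linear map given by the sign matrix `G`. -/
def signMatrixMap {m N : ℕ} (G : Fin m → Fin N → Bool) :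
    (Fin N → ℝ) →ₗ[ℝ] EuclideanSpace ℝ (Fin m) where
  toFun x := WithLp.toLp 2 fun i => signedSum (G i) x
  map_add' x y := by
    ext i; simp [signedSum, mul_add, Finset.sum_add_distrib]
  map_smul' c x := by
    ext i; simp [signedSum, Finset.mul_sum, mul_left_comm]

lemma norm_signMatrixMap_sq {m N : ℕ} (G : Fin m → Fin N → Bool) (x : Fin N → ℝ) :
    ‖signMatrixMap G x‖ ^ 2 = signMatrixSq G x := by
  simp [signMatrixMap, EuclideanSpace.norm_sq_eq, signMatrixSq]

/-- Rounding of a real number towards zero. -/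
noncomputable def truncInt (t : ℝ) : ℤ := if 0 ≤ t then ⌊t⌋ else ⌈t⌉

lemma truncInt_neg (t : ℝ) : truncInt (-t) = -truncInt t := by
  unfold truncInt
  rcases lt_trichotomy t 0 with h | h | h
  · rw [if_pos (by linarith), if_neg (by linarith), Int.floor_neg]
  · simp [h]
  · rw [if_neg (by linarith), if_pos h.le, Int.ceil_neg]

lemma truncInt_spec_of_nonneg {t : ℝ} (ht : 0 ≤ t) :
    |(truncInt t : ℝ)| ≤ |t| ∧ |t - truncInt t| ≤ 1 ∧ |t - truncInt t| ≤ |t| ∧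
      |truncInt t - 2 * truncInt (t / 2)| ≤ 1 ∧
      |truncInt t - 2 * truncInt (t / 2)| ≤ |truncInt t| := by
  have ht2 : 0 ≤ t / 2 := by linarith
  rw [truncInt, truncInt, if_pos ht, if_pos ht2]
  have h0 : 0 ≤ ⌊t⌋ := Int.floor_nonneg.2 ht
  have h0' : (0 : ℝ) ≤ ⌊t⌋ := by exact_mod_cast h0
  have h1 := Int.floor_le t
  have h2 := Int.lt_floor_add_one t
  have h3 := Int.floor_le (t / 2)
  have h4 := Int.lt_floor_add_one (t / 2)
  have h5 : 0 ≤ ⌊t / 2⌋ := Int.floor_nonneg.2 ht2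
  have h6 : 2 * ⌊t / 2⌋ ≤ ⌊t⌋ := Int.le_floor.2 (by push_cast; linarith)
  have h7 : ⌊t⌋ < 2 * ⌊t / 2⌋ + 2 := Int.floor_lt.2 (by push_cast; linarith)
  have h8 : 0 ≤ t - ⌊t⌋ := by linarith
  refine ⟨?_, ?_, ?_, ?_, ?_⟩
  · rw [abs_of_nonneg h0', abs_of_nonneg ht]; exact h1
  · rw [abs_of_nonneg h8]; linarith
  · rw [abs_of_nonneg h8, abs_of_nonneg ht]; linarith
  · rw [abs_le]; omega
  · rw [abs_of_nonneg h0, abs_le]; omega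

lemma truncInt_spec (t : ℝ) :
    |(truncInt t : ℝ)| ≤ |t| ∧ |t - truncInt t| ≤ 1 ∧ |t - truncInt t| ≤ |t| ∧
      |truncInt t - 2 * truncInt (t / 2)| ≤ 1 ∧
      |truncInt t - 2 * truncInt (t / 2)| ≤ |truncInt t| := by
  rcases le_total 0 t with ht | ht
  · exact truncInt_spec_of_nonneg ht
  · obtain ⟨h1, h2, h3, h4, h5⟩ := truncInt_spec_of_nonneg (t := -t) (by linarith)
    rw [neg_div, truncInt_neg, truncInt_neg] at h4 h5
    rw [truncInt_neg] at h1 h2 h3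
    push_cast at h1 h2 h3
    rw [abs_neg, abs_neg] at h1
    rw [show -t - -(truncInt t : ℝ) = -(t - truncInt t) by ring, abs_neg] at h2 h3
    rw [abs_neg] at h3
    rw [show -truncInt t - 2 * -truncInt (t / 2)
      = -(truncInt t - 2 * truncInt (t / 2)) by ring, abs_neg] at h4 h5
    rw [abs_neg] at h5
    exact ⟨h1, h2, h3, h4, h5⟩

lemma abs_truncInt_le_rpow (t : ℝ) {p : ℝ} (hp : 1 ≤ p) : |(truncInt t : ℝ)| ≤ |t| ^ p := by
  have h := (truncInt_spec t).1
  rcases eq_or_ne (truncInt t) 0 with h0 | h0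
  · rw [h0]; simp; positivity
  · have h1 : (1 : ℝ) ≤ |(truncInt t : ℝ)| := by exact_mod_cast Int.one_le_abs h0
    exact h.trans (Real.self_le_rpow_of_one_le (h1.trans h) hp)

/-- A convex function on the cube `[-1, 1]^N` is dominated by its values at the vertices. -/
lemma norm_map_le_of_forall_signs {m N : ℕ} (f : (Fin N → ℝ) →ₗ[ℝ] EuclideanSpace ℝ (Fin m))
    {B : ℝ} (hB : ∀ n : Fin N → ℤ, (∀ j, |n j| ≤ 1) → ‖f (fun j => (n j : ℝ))‖ ≤ B)
    {w : Fin N → ℝ} (hw : ∀ j, |w j| ≤ 1) : ‖f w‖ ≤ B := by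
  have hmem : w ∈ convexHull ℝ (Set.univ.pi fun _ : Fin N => ({-1, 1} : Set ℝ)) := by
    rw [convexHull_pi]
    intro j _
    rw [convexHull_pair, segment_eq_Icc (by norm_num)]
    exact abs_le.1 (hw j)
  have hconv : ConvexOn ℝ (convexHull ℝ (Set.univ.pi fun _ : Fin N => ({-1, 1} : Set ℝ)))
      fun x => ‖f x‖ :=
    (convexOn_univ_norm.comp_linearMap f).subset (Set.subset_univ _) (convex_convexHull ℝ _)
  obtain ⟨y, hy, hle⟩ := hconv.exists_ge_of_mem_convexHull (subset_convexHull ℝ _) hmem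
  refine hle.trans ?_
  have hy' : ∀ j, ∃ k : ℤ, |k| ≤ 1 ∧ (k : ℝ) = y j := fun j => by
    rcases hy j (Set.mem_univ j) with h | h
    · exact ⟨-1, by norm_num, by rw [h]; norm_num⟩
    · exact ⟨1, by norm_num, by rw [h]; norm_num⟩
  choose n hn1 hn2 using hy'
  have := hB n hn1
  simpa only [hn2] using this

lemma sum_abs_truncInt_le {N : ℕ} {p h : ℝ} (hp : 1 ≤ p) (hh : 0 < h) {x : Fin N → ℝ}
    (hx : ∑ j, |x j| ^ p ≤ 1) : ∑ j, |(truncInt (x j / h) : ℝ)| ≤ h ^ (-p) := by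
  calc ∑ j, |(truncInt (x j / h) : ℝ)| ≤ ∑ j, |x j| ^ p * h ^ (-p) := by
        refine Finset.sum_le_sum fun j _ => (abs_truncInt_le_rpow _ hp).trans (le_of_eq ?_)
        rw [abs_div, abs_of_pos hh, Real.div_rpow (abs_nonneg _) hh.le, Real.rpow_neg hh.le,
          div_eq_mul_inv]
    _ ≤ 1 * h ^ (-p) := by rw [← Finset.sum_mul]; gcongr
    _ = _ := one_mul _

lemma sum_sub_truncInt_sq_le {N : ℕ} {p h : ℝ} (hp0 : 0 < p) (hp : p ≤ 2) (hh : 0 < h)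
    {x : Fin N → ℝ} (hx : ∑ j, |x j| ^ p ≤ 1) :
    ∑ j, (x j - h * truncInt (x j / h)) ^ 2 ≤ h ^ (2 - p) := by
  calc ∑ j, (x j - h * truncInt (x j / h)) ^ 2 ≤ ∑ j, h ^ (2 - p) * |x j| ^ p := by
        refine Finset.sum_le_sum fun j _ => ?_
        obtain ⟨-, h2, h3, -, -⟩ := truncInt_spec (x j / h)
        have e : x j - h * truncInt (x j / h) = h * (x j / h - truncInt (x j / h)) := by
          field_simp
        have h2' : |x j - h * truncInt (x j / h)| ≤ h := by
          rw [e, abs_mul, abs_of_pos hh]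
          exact mul_le_of_le_one_right hh.le h2
        have h3' : |x j - h * truncInt (x j / h)| ≤ |x j| := by
          rw [e, abs_mul, abs_of_pos hh]
          rw [abs_div, abs_of_pos hh, le_div_iff₀ hh, mul_comm] at h3
          exact h3
        calc (x j - h * truncInt (x j / h)) ^ 2
            = |x j - h * truncInt (x j / h)| ^ ((2 - p) + p) := by
              rw [sub_add_cancel, Real.rpow_two, sq_abs]
          _ = |x j - h * truncInt (x j / h)| ^ (2 - p) * |x j - h * truncInt (x j / h)| ^ p :=
              Real.rpow_add_of_nonneg (abs_nonneg _) (by linarith) hp0.le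
          _ ≤ _ := by
              gcongr
    _ ≤ h ^ (2 - p) * 1 := by rw [← Finset.mul_sum]; gcongr
    _ = _ := mul_one _

/-- A vector in the kernel of a well-behaved sign matrix that lies in the unit ball of `ℓ_p` has
small Euclidean norm. -/
lemma sum_sq_le_of_mem_ker {p r K D : ℝ} (hr : 1 < r) (hrp : r < p) (hp2 : p ≤ 2) (hK : 0 < K)
    {N m I : ℕ} (hN : 0 < N) (G : Fin m → Fin N → Bool)
    (hI : m * ((2 : ℝ) ^ I) ^ r ≤ D * N)
    (hU : ∀ i ≤ I, ∀ n : Fin N → ℤ, (∀ j, |n j| ≤ 1) →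
      ∑ j, |(n j : ℝ)| ≤ N * ((2 : ℝ) ^ i) ^ (-p) →
      signMatrixSq G (fun j => (n j : ℝ))
        ≤ K * (N * ((2 : ℝ) ^ i) ^ (-p)) * (N * ((2 : ℝ) ^ i) ^ (-r)))
    (hL : ∀ n : Fin N → ℤ, ∑ j, |(n j : ℝ)| ≤ N * ((2 : ℝ) ^ I) ^ (-p) →
      m * ∑ j, (n j : ℝ) ^ 2 ≤ 4 * signMatrixSq G (fun j => (n j : ℝ)))
    {x : Fin N → ℝ} (hker : ∀ i, signedSum (G i) x = 0) (hx : ∑ j, |x j| ^ p ≤ 1) :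
    m * ∑ j, x j ^ 2 ≤ (8 * (K * ((1 - (2 : ℝ) ^ (1 - (p + r) / 2))⁻¹ + 1) ^ 2) + 2 * D)
      * ((N : ℝ) ^ (1 - 1 / p)) ^ 2 := by
  have hp1 : 1 < p := hr.trans hrp
  have hp0 : 0 < p := by linarith
  have hN0 : (0 : ℝ) < N := by exact_mod_cast hN
  set η : ℝ := (N : ℝ) ^ (-(1 / p)) with hη
  have hη0 : 0 < η := by positivity
  have hηN : η * N = (N : ℝ) ^ (1 - 1 / p) := by
    rw [hη, sub_eq_neg_add, Real.rpow_add hN0, Real.rpow_one]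
  have hηp : η ^ (-p) = N := by
    rw [hη, ← Real.rpow_mul hN0.le, neg_mul_neg, one_div_mul_cancel hp0.ne', Real.rpow_one]
  set q : ℝ := (2 : ℝ) ^ (1 - (p + r) / 2) with hq
  have hq0 : 0 < q := by positivity
  have hq1 : q < 1 := Real.rpow_lt_one_of_one_lt_of_neg (by norm_num) (by linarith)
  set h : ℕ → ℝ := fun i => 2 ^ i * η with hh
  have hh0 : ∀ i, 0 < h i := fun i => by positivity
  have hhp : ∀ i, h i ^ (-p) = N * ((2 : ℝ) ^ i) ^ (-p) := fun i => by
    rw [hh, Real.mul_rpow (by positivity) hη0.le, hηp, mul_comm]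
  set n : ℕ → Fin N → ℤ := fun i j => truncInt (x j / h i) with hn
  set f := signMatrixMap G with hf
  have hfU : ∀ i ≤ I, ∀ k : Fin N → ℤ, (∀ j, |k j| ≤ 1) →
      ∑ j, |(k j : ℝ)| ≤ N * ((2 : ℝ) ^ i) ^ (-p) →
      ‖f (fun j => (k j : ℝ))‖ ≤ √K * N * ((2 : ℝ) ^ i) ^ (-((p + r) / 2)) := by
    intro i hi k hk1 hk2
    refine le_of_sq_le_sq ?_ (by positivity)
    rw [norm_signMatrixMap_sq]
    refine (hU i hi k hk1 hk2).trans (le_of_eq ?_)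
    have e1 : ((2 : ℝ) ^ i) ^ (-p) * ((2 : ℝ) ^ i) ^ (-r)
        = ((2 : ℝ) ^ i) ^ (-((p + r) / 2)) * ((2 : ℝ) ^ i) ^ (-((p + r) / 2)) := by
      rw [← Real.rpow_add (by positivity), ← Real.rpow_add (by positivity)]; ring_nf
    rw [mul_pow, mul_pow, Real.sq_sqrt hK.le, sq (((2 : ℝ) ^ i) ^ (-((p + r) / 2))), ← e1]
    ring
  have hnsum : ∀ i, ∑ j, |(n i j : ℝ)| ≤ N * ((2 : ℝ) ^ i) ^ (-p) := fun i =>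
    (sum_abs_truncInt_le hp1.le (hh0 i) hx).trans_eq (hhp i)
  have hstep : ∀ i < I, ‖f (fun j => h i * n i j) - f (fun j => h (i + 1) * n (i + 1) j)‖
      ≤ √K * (η * N) * q ^ i := by
    intro i hi
    set e : Fin N → ℤ := fun j => n i j - 2 * n (i + 1) j with he
    have hhalf : ∀ j, n (i + 1) j = truncInt (x j / h i / 2) := fun j => by
      simp only [hn, hh, pow_succ]; congr 1; field_simp
    have hspec := fun j => truncInt_spec (x j / h i)
    have he1 : ∀ j, |e j| ≤ 1 := fun j => by
      simp only [he, hhalf]; exact (hspec j).2.2.2.1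
    have he2 : ∀ j, |(e j : ℝ)| ≤ |(n i j : ℝ)| := fun j => by
      have : |e j| ≤ |n i j| := by simp only [he, hhalf]; exact (hspec j).2.2.2.2
      exact_mod_cast this
    have hfe : f (fun j => h i * n i j) - f (fun j => h (i + 1) * n (i + 1) j)
        = h i • f (fun j => (e j : ℝ)) := by
      rw [← map_sub, ← map_smul]
      congr 1; ext j
      simp only [Pi.sub_apply, Pi.smul_apply, smul_eq_mul, he, hh]
      push_cast; ring
    rw [hfe, norm_smul, Real.norm_of_nonneg (hh0 i).le]
    have h1 := hfU i hi.le e he1 ((Finset.sum_le_sum fun j _ => he2 j).trans (hnsum i))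
    refine (mul_le_mul_of_nonneg_left h1 (hh0 i).le).trans (le_of_eq ?_)
    have h2 : (2 : ℝ) ^ i * ((2 : ℝ) ^ i) ^ (-((p + r) / 2)) = q ^ i := by
      rw [hq, ← Real.rpow_natCast, ← Real.rpow_natCast, ← Real.rpow_mul (by norm_num),
        ← Real.rpow_mul (by norm_num), ← Real.rpow_add (by norm_num)]
      congr 1; ring
    rw [← h2]; simp only [hh]; ring
  have hrem : ‖f (fun j => x j - h 0 * n 0 j)‖ ≤ √K * (η * N) := by
    have h1 : f (fun j => x j - h 0 * n 0 j)
        = η • f (fun j => x j / η - truncInt (x j / η)) := by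
      rw [← map_smul]; congr 1; ext j
      simp only [Pi.smul_apply, smul_eq_mul, hn, hh, pow_zero, one_mul]; field_simp
    have h2 := norm_map_le_of_forall_signs f (B := √K * N)
      (w := fun j => x j / η - truncInt (x j / η)) (fun k hk => by
        have h3 := hfU 0 (Nat.zero_le _) k hk (by
          simp only [pow_zero, Real.one_rpow, mul_one]
          calc ∑ j, |(k j : ℝ)| ≤ ∑ _j : Fin N, (1 : ℝ) :=
                Finset.sum_le_sum fun j _ => by exact_mod_cast hk j
            _ = N := by simp)
        simpa using h3) (fun j => (truncInt_spec _).2.1)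
    rw [h1, norm_smul, Real.norm_of_nonneg hη0.le]
    calc _ ≤ η * (√K * N) := by gcongr
      _ = _ := by ring
  have hfx : f x = 0 := by
    ext i; simp [hf, signMatrixMap, hker]
  have htop : ‖f (fun j => h I * n I j)‖ ≤ √K * (η * N) * ((1 - q)⁻¹ + 1) := by
    have e1 : f (fun j => h I * n I j)
        = -(∑ i ∈ Finset.range I, (f (fun j => h i * n i j)
            - f (fun j => h (i + 1) * n (i + 1) j)) + f (fun j => x j - h 0 * n 0 j)) := by
      rw [Finset.sum_range_sub' (fun i => f (fun j => h i * n i j))]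
      have : f (fun j => x j - h 0 * n 0 j) = f x - f (fun j => h 0 * n 0 j) := by
        rw [← map_sub]; rfl
      rw [this, hfx]; abel
    rw [e1, norm_neg]
    calc _ ≤ ∑ i ∈ Finset.range I, √K * (η * N) * q ^ i + √K * (η * N) :=
          (norm_add_le _ _).trans (add_le_add ((norm_sum_le _ _).trans
            (Finset.sum_le_sum fun i hi => hstep i (Finset.mem_range.1 hi))) hrem)
      _ ≤ √K * (η * N) * (1 - q)⁻¹ + √K * (η * N) := by
          rw [← Finset.mul_sum]
          gcongr
          rw [← tsum_geometric_of_lt_one hq0.le hq1]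
          exact (summable_geometric_of_lt_one hq0.le hq1).sum_le_tsum _ fun _ _ => by positivity
      _ = _ := by ring
  have hz : m * ∑ j, (h I * n I j) ^ 2 ≤ 4 * (K * ((1 - q)⁻¹ + 1) ^ 2 * (η * N) ^ 2) := by
    have h1 := hL (n I) (hnsum I)
    have h2 : f (fun j => h I * n I j) = h I • f (fun j => (n I j : ℝ)) := by
      rw [← map_smul]; rfl
    have h3 : ‖f (fun j => h I * n I j)‖ ^ 2 = h I ^ 2 * signMatrixSq G (fun j => (n I j : ℝ)) := by
      rw [h2, norm_smul, mul_pow, norm_signMatrixMap_sq, Real.norm_eq_abs, sq_abs]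
    have h4 : ‖f (fun j => h I * n I j)‖ ^ 2 ≤ (√K * (η * N) * ((1 - q)⁻¹ + 1)) ^ 2 := by gcongr
    rw [h3, mul_pow _ ((1 - q)⁻¹ + 1), mul_pow (√K), Real.sq_sqrt hK.le] at h4
    have h5 : m * ∑ j, (h I * n I j) ^ 2 = h I ^ 2 * (m * ∑ j, (n I j : ℝ) ^ 2) := by
      simp only [mul_pow, ← Finset.mul_sum]; ring
    rw [h5]
    have := mul_le_mul_of_nonneg_left h1 (sq_nonneg (h I))
    linarith
  have hy : m * ∑ j, (x j - h I * n I j) ^ 2 ≤ D * (η * N) ^ 2 := by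
    have h1 : h I ^ (2 - p) ≤ ((2 : ℝ) ^ I) ^ r * (η ^ 2 * N) := by
      rw [hh, Real.mul_rpow (by positivity) hη0.le]
      have h2 : η ^ (2 - p) = η ^ 2 * N := by
        rw [sub_eq_add_neg, Real.rpow_add hη0, hηp, Real.rpow_two]
      rw [h2]
      gcongr
      · exact one_le_pow₀ (by norm_num)
      · linarith
    calc m * ∑ j, (x j - h I * n I j) ^ 2 ≤ m * (((2 : ℝ) ^ I) ^ r * (η ^ 2 * N)) := by
          gcongr
          exact (sum_sub_truncInt_sq_le hp0 hp2 (hh0 I) hx).trans h1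
      _ = m * ((2 : ℝ) ^ I) ^ r * (η ^ 2 * N) := by ring
      _ ≤ D * N * (η ^ 2 * N) := by gcongr
      _ = _ := by ring
  rw [← hηN]
  calc m * ∑ j, x j ^ 2
      ≤ m * ∑ j, (2 * (h I * n I j) ^ 2 + 2 * (x j - h I * n I j) ^ 2) := by
        gcongr with j
        nlinarith [sq_nonneg (h I * n I j - (x j - h I * n I j))]
    _ = 2 * (m * ∑ j, (h I * n I j) ^ 2) + 2 * (m * ∑ j, (x j - h I * n I j) ^ 2) := by
        rw [Finset.sum_add_distrib, ← Finset.mul_sum, ← Finset.mul_sum]; ring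
    _ ≤ _ := by linarith

/-- There is a real subspace of codimension `m` on which the Euclidean norm is controlled by
`N ^ (1 - 1 / p) / √m` times the `ℓ_p` norm. -/
lemma exists_signMatrix_ker_le {p : ℝ} (hp1 : 1 < p) (hp2 : p ≤ 2) :
    ∃ C : ℝ, 0 < C ∧ ∀ N m : ℕ, 24 ≤ m → m ≤ N → ∃ G : Fin m → Fin N → Bool,
      ∀ x : Fin N → ℝ, (∀ i, signedSum (G i) x = 0) → ∑ j, |x j| ^ p ≤ 1 →
        m * ∑ j, x j ^ 2 ≤ C * ((N : ℝ) ^ (1 - 1 / p)) ^ 2 := by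
  have hr : 1 < (1 + p) / 2 := by linarith
  have hrp : (1 + p) / 2 < p := by linarith
  obtain ⟨K, D, hK, hD, H⟩ := exists_signMatrix hr hrp
  refine ⟨8 * (K * ((1 - (2 : ℝ) ^ (1 - (p + (1 + p) / 2) / 2))⁻¹ + 1) ^ 2) + 2 * D,
    by positivity, fun N m hm hmN => ?_⟩
  obtain ⟨I, hI, G, hU, hL⟩ := H N m hm hmN
  exact ⟨G, fun x hx hx1 => sum_sq_le_of_mem_ker hr hrp hp2 hK (by omega) G hI hU hL hx hx1⟩

/-- On the kernel of a complex linear map into `ℂ^m`, `m < k`, the Euclidean norm is controlled by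
`min 1 (N ^ (1 - 1 / p) / √k)` times the `ℓ_p` norm. -/
lemma exists_linearMap_ker_le {p : ℝ} (hp1 : 1 < p) (hp2 : p ≤ 2) :
    ∃ C : ℝ, 0 < C ∧ ∀ N k : ℕ, 1 ≤ k → k ≤ N →
      ∃ m < k, ∃ g : (Fin N → ℂ) →ₗ[ℂ] (Fin m → ℂ), ∀ x, g x = 0 → ∑ j, ‖x j‖ ^ p ≤ 1 →
        ∑ j, ‖x j‖ ^ 2 ≤ (C * min 1 ((N : ℝ) ^ (1 - 1 / p) * (k : ℝ) ^ (-(1/2) : ℝ))) ^ 2 := by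
  obtain ⟨C, hC, H⟩ := exists_signMatrix_ker_le hp1 hp2
  refine ⟨max 5 (2 * √C), by positivity, fun N k hk hkN => ?_⟩
  have hk0 : (0 : ℝ) < k := by exact_mod_cast hk
  have hN1 : (1 : ℝ) ≤ N := by exact_mod_cast hk.trans hkN
  have hksq : ((k : ℝ) ^ (-(1/2) : ℝ)) ^ 2 = (k : ℝ)⁻¹ := by
    rw [← Real.rpow_natCast, ← Real.rpow_mul hk0.le]; norm_num [Real.rpow_neg_one]
  set ξ := (N : ℝ) ^ (1 - 1 / p) * (k : ℝ) ^ (-(1/2) : ℝ) with hξ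
  have hξ0 : 0 ≤ ξ := by positivity
  have hNa : 1 ≤ (N : ℝ) ^ (1 - 1 / p) := Real.one_le_rpow hN1 (by
    rw [sub_nonneg, div_le_one (by linarith)]; exact hp1.le)
  by_cases hcase : 1 ≤ ξ ∨ k < 25
  · refine ⟨0, hk, 0, fun x _ hx => ?_⟩
    have hle : ∀ j, ‖x j‖ ≤ 1 := fun j => by
      have h1 := (Finset.single_le_sum (f := fun j => ‖x j‖ ^ p) (fun _ _ => by positivity)
        (Finset.mem_univ j)).trans hx
      by_contra! h2
      exact absurd h1 (not_le.2 (Real.one_lt_rpow h2 (by linarith)))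
    have hsum : ∑ j, ‖x j‖ ^ 2 ≤ 1 := by
      refine (Finset.sum_le_sum fun j _ => ?_).trans hx
      rw [← Real.rpow_natCast]
      exact Real.rpow_le_rpow_of_exponent_ge_of_imp (norm_nonneg _) (hle j) (by simpa using hp2)
        (fun _ h => absurd h (by norm_num))
    refine hsum.trans (one_le_pow₀ ?_)
    have h5 : (1 : ℝ) / 5 ≤ min 1 ξ := by
      refine le_min (by norm_num) ?_
      rcases hcase with h | h
      · linarith
      · refine le_of_sq_le_sq ?_ hξ0
        rw [hξ, mul_pow, hksq]
        have hk25 : (k : ℝ) ≤ 25 := by exact_mod_cast h.le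
        calc ((1 : ℝ) / 5) ^ 2 = 1 * (25 : ℝ)⁻¹ := by norm_num
          _ ≤ _ := mul_le_mul (one_le_pow₀ hNa) (inv_anti₀ hk0 hk25) (by norm_num) (by positivity)
    calc (1 : ℝ) = 5 * (1 / 5) := by norm_num
      _ ≤ max 5 (2 * √C) * min 1 ξ :=
        mul_le_mul (le_max_left _ _) h5 (by norm_num) (by positivity)
  · push Not at hcase
    obtain ⟨m, rfl⟩ : ∃ m, k = m + 1 := ⟨k - 1, by omega⟩
    obtain ⟨G, hG⟩ := H N m (by omega) (by omega)
    refine ⟨m, by omega, LinearMap.pi fun i => ∑ j, (boolSign (G i j) : ℂ) • LinearMap.proj j,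
      fun x hgx hx => ?_⟩
    have hzero : ∀ i, ∑ j, (boolSign (G i j) : ℂ) * x j = 0 := fun i => by
      have := congrFun hgx i
      simpa using this
    have hre : ∀ i, signedSum (G i) (fun j => (x j).re) = 0 := fun i => by
      have := congrArg Complex.re (hzero i)
      simpa [signedSum] using this
    have him : ∀ i, signedSum (G i) (fun j => (x j).im) = 0 := fun i => by
      have := congrArg Complex.im (hzero i)
      simpa [signedSum] using this
    have h1 := hG _ hre (le_trans (Finset.sum_le_sum fun j _ => Real.rpow_le_rpow (abs_nonneg _)
      (Complex.abs_re_le_norm _) (by linarith)) hx)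
    have h2 := hG _ him (le_trans (Finset.sum_le_sum fun j _ => Real.rpow_le_rpow (abs_nonneg _)
      (Complex.abs_im_le_norm _) (by linarith)) hx)
    have h3 : ∑ j, ‖x j‖ ^ 2 = ∑ j, (x j).re ^ 2 + ∑ j, (x j).im ^ 2 := by
      rw [← Finset.sum_add_distrib]
      refine Finset.sum_congr rfl fun j _ => ?_
      rw [Complex.sq_norm, Complex.normSq_apply]; ring
    have h4 : m * ∑ j, ‖x j‖ ^ 2 ≤ 2 * (C * ((N : ℝ) ^ (1 - 1 / p)) ^ 2) := by
      rw [h3]; linarith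
    have hm24 : (24 : ℝ) ≤ m := by exact_mod_cast (by omega : 24 ≤ m)
    have hsq : (2 * √C * ξ) ^ 2 = 4 * C * ((N : ℝ) ^ (1 - 1 / p)) ^ 2 * ((m : ℝ) + 1)⁻¹ := by
      rw [hξ, mul_pow, mul_pow, mul_pow, hksq, Real.sq_sqrt hC.le]; push_cast; ring
    have h6 : ∑ j, ‖x j‖ ^ 2 ≤ (2 * √C * ξ) ^ 2 := by
      rw [hsq, ← div_eq_mul_inv, le_div_iff₀ (by linarith)]
      have : 0 ≤ ∑ j, ‖x j‖ ^ 2 := by positivity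
      nlinarith
    rw [min_eq_right hcase.1.le]
    refine h6.trans ?_
    gcongr
    exact le_max_right _ _

lemma sum_rpow_le_of_sum_rpow_le_one {ι : Type*} (s : Finset ι) {y : ι → ℝ} (hy : ∀ j, 0 ≤ y j)
    {p q : ℝ} (hp : 0 < p) (hpq : p < q) (hq : q ≤ 2) (h1 : ∑ j ∈ s, y j ^ p ≤ 1) :
    ∑ j ∈ s, y j ^ q ≤ (∑ j ∈ s, y j ^ 2) ^ ((q - p) / (2 - p)) := by
  set A := ∑ j ∈ s, y j ^ 2 with hA
  set t := (q - p) / (2 - p) with ht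
  have h2p : 0 < 2 - p := by linarith
  have ht0 : 0 < t := div_pos (by linarith) h2p
  have ht1 : t ≤ 1 := (div_le_one h2p).2 (by linarith)
  have htq : p * (1 - t) + 2 * t = q := by rw [ht]; field_simp; ring
  rcases (Finset.sum_nonneg fun j _ => sq_nonneg (y j) : 0 ≤ A).eq_or_lt with h0 | h0
  · have hz : ∀ j ∈ s, y j = 0 := fun j hj => by
      have := (Finset.sum_eq_zero_iff_of_nonneg fun j _ => sq_nonneg (y j)).1 h0.symm j hj
      exact pow_eq_zero_iff (two_ne_zero) |>.1 this
    rw [Finset.sum_eq_zero fun j hj => by rw [hz j hj, Real.zero_rpow (by linarith)]]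
    positivity
  · calc ∑ j ∈ s, y j ^ q
        ≤ ∑ j ∈ s, A ^ t * ((1 - t) * y j ^ p + t * (y j ^ 2 / A)) := by
          refine Finset.sum_le_sum fun j _ => ?_
          have h2 := Real.geom_mean_le_arith_mean2_weighted (sub_nonneg.2 ht1) ht0.le
            (Real.rpow_nonneg (hy j) p) (div_nonneg (sq_nonneg (y j)) h0.le) (by ring)
          refine le_trans (le_of_eq ?_) (mul_le_mul_of_nonneg_left h2 (by positivity))
          rw [← Real.rpow_mul (hy j), Real.div_rpow (sq_nonneg _) h0.le, ← Real.rpow_natCast,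
            ← Real.rpow_mul (hy j), mul_div_assoc', mul_div_cancel₀ _ (by positivity),
            ← Real.rpow_add_of_nonneg (hy j) (by nlinarith) (by positivity)]
          norm_num [htq]
      _ = A ^ t * ((1 - t) * ∑ j ∈ s, y j ^ p + t * (A / A)) := by
          rw [← Finset.mul_sum, Finset.sum_add_distrib, ← Finset.mul_sum, ← Finset.mul_sum,
            ← Finset.sum_div]
      _ ≤ A ^ t * ((1 - t) * 1 + t * 1) := by
          rw [div_self h0.ne']
          gcongr
      _ = A ^ t := by ring

lemma gelfandNumber_le {X Y : Type*} [NormedAddCommGroup X] [NormedSpace ℂ X]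
    [FiniteDimensional ℂ X] [NormedAddCommGroup Y] [NormedSpace ℂ Y] (T : X →L[ℂ] Y) {k m : ℕ}
    (hm : m < k) (g : X →ₗ[ℂ] (Fin m → ℂ)) {B : ℝ}
    (hB : ∀ x, g x = 0 → ‖x‖ ≤ 1 → ‖T x‖ ≤ B) : gelfandNumber T k ≤ B := by
  have hle : (⨆ x : {x : LinearMap.ker g // ‖(x : X)‖ ≤ 1}, ‖T (x : X)‖) ≤ B :=
    haveI : Nonempty {x : LinearMap.ker g // ‖(x : X)‖ ≤ 1} := ⟨⟨0, by simp⟩⟩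
    ciSup_le fun x => hB _ x.1.2 x.2
  refine le_trans (csInf_le ?_ ?_) hle
  · refine ⟨0, ?_⟩
    rintro r ⟨M, -, -, rfl⟩
    exact Real.iSup_nonneg fun _ => norm_nonneg _
  · refine ⟨LinearMap.ker g, Submodule.closed_of_finiteDimensional _, ?_, rfl⟩
    rw [← Module.finrank_eq_rank, Nat.cast_lt, g.quotKerEquivRange.finrank_eq]
    refine lt_of_le_of_lt (Submodule.finrank_le _) ?_
    simpa using hm

lemma le_gelfandNumber {X Y : Type*} [NormedAddCommGroup X] [NormedSpace ℂ X]
    [FiniteDimensional ℂ X] [NormedAddCommGroup Y] [NormedSpace ℂ Y] (T : X →L[ℂ] Y) {k : ℕ}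
    (hk : 1 ≤ k) {B : ℝ}
    (hB : ∀ M : Submodule ℂ X, Module.finrank ℂ X < Module.finrank ℂ M + k →
      ∃ x ∈ M, x ≠ 0 ∧ B * ‖x‖ ≤ ‖T x‖) : B ≤ gelfandNumber T k := by
  refine le_csInf ⟨_, ⊤, isClosed_univ, ?_, rfl⟩ ?_
  · rw [← Module.finrank_eq_rank, Nat.cast_lt]
    have := (⊤ : Submodule ℂ X).finrank_quotient_add_finrank
    rw [finrank_top] at this
    omega
  · rintro r ⟨M, -, hM, rfl⟩
    rw [← Module.finrank_eq_rank, Nat.cast_lt] at hM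
    have := M.finrank_quotient_add_finrank
    obtain ⟨x, hxM, hx0, hx⟩ := hB M (by omega)
    have hnx : 0 < ‖x‖ := norm_pos_iff.2 hx0
    have hc : ‖((‖x‖⁻¹ : ℝ) : ℂ)‖ = ‖x‖⁻¹ := by
      rw [Complex.norm_real, Real.norm_of_nonneg (by positivity)]
    have hbdd : BddAbove (Set.range fun x : {x : M // ‖(x : X)‖ ≤ 1} => ‖T (x : X)‖) := by
      refine ⟨‖T‖, ?_⟩
      rintro _ ⟨y, rfl⟩
      exact T.unit_le_opNorm _ y.2
    refine le_trans ?_ (le_ciSup hbdd ⟨⟨((‖x‖⁻¹ : ℝ) : ℂ) • x, M.smul_mem _ hxM⟩, by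
      simp only [norm_smul, hc]; rw [inv_mul_cancel₀ hnx.ne']⟩)
    simp only [map_smul, norm_smul, hc]
    rw [inv_mul_eq_div, le_div_iff₀ hnx]
    exact hx

lemma exists_subset_card_eq_mul_sum_le {ι : Type*} [DecidableEq ι] (w : ι → ℝ) (s d : ℕ) :
    ∀ U : Finset ι, U.card = s + d →
      ∃ S ⊆ U, S.card = s ∧ (U.card : ℝ) * ∑ i ∈ S, w i ≤ s * ∑ i ∈ U, w i := by
  induction d with
  | zero => exact fun U hU => ⟨U, subset_rfl, hU, by rw [hU]; simp⟩
  | succ d ih =>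
    intro U hU
    have hne : U.Nonempty := Finset.card_pos.1 (by omega)
    obtain ⟨i, hi, hmax⟩ := U.exists_max_image w hne
    have hcard : (U.erase i).card = s + d := by rw [Finset.card_erase_of_mem hi]; omega
    obtain ⟨S, hS, hSs, hle⟩ := ih (U.erase i) hcard
    refine ⟨S, hS.trans (U.erase_subset i), hSs, ?_⟩
    rcases Nat.eq_zero_or_pos (s + d) with h0 | h0
    · obtain rfl : s = 0 := by omega
      rw [Finset.card_eq_zero.1 hSs]
      simp
    · have h1 : ∑ j ∈ U, w j ≤ (s + d + 1) * w i := by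
        refine (U.sum_le_card_nsmul w (w i) hmax).trans_eq ?_
        rw [hU, nsmul_eq_mul]; push_cast; ring
      have h2 := U.sum_erase_eq_sub (f := w) hi
      have h3 : (0 : ℝ) < s + d := by exact_mod_cast h0
      have hs : (0 : ℝ) ≤ s := Nat.cast_nonneg s
      rw [hcard, h2] at hle
      rw [hU]
      push_cast at hle ⊢
      refine le_of_mul_le_mul_left ?_ h3
      have h4 := mul_le_mul_of_nonneg_left hle (by positivity : (0 : ℝ) ≤ s + d + 1)
      have h5 := mul_le_mul_of_nonneg_left h1 hs
      linarith

lemma exists_signs_norm_sum_sq_le {ι E : Type*} [DecidableEq ι] [NormedAddCommGroup E]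
    [InnerProductSpace ℂ E] (f : ι → E) (S : Finset ι) :
    ∃ ε : ι → ℂ, (∀ i, ‖ε i‖ = 1) ∧ ‖∑ i ∈ S, ε i • f i‖ ^ 2 ≤ ∑ i ∈ S, ‖f i‖ ^ 2 := by
  induction S using Finset.induction_on with
  | empty => exact ⟨fun _ => 1, by simp, by simp⟩
  | insert i S hi ih =>
    obtain ⟨ε, hε, hle⟩ := ih
    have hsum : ∀ c : ℂ, ∑ j ∈ insert i S, Function.update ε i c j • f j
        = ∑ j ∈ S, ε j • f j + c • f i := fun c => by
      rw [Finset.sum_insert hi, Function.update_self, add_comm]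
      congr 1
      exact Finset.sum_congr rfl fun j hj => by
        rw [Function.update_of_ne (ne_of_mem_of_not_mem hj hi)]
    have hnorm : ∀ c : ℂ, ‖c‖ = 1 → ∀ j, ‖Function.update ε i c j‖ = 1 := fun c hc j => by
      rcases eq_or_ne j i with rfl | h
      · simpa using hc
      · rw [Function.update_of_ne h, hε]
    have hpar := parallelogram_law_with_norm ℂ (∑ j ∈ S, ε j • f j) (f i)
    rw [Finset.sum_insert hi]
    by_cases h : ‖∑ j ∈ S, ε j • f j + f i‖ ^ 2 ≤ ‖f i‖ ^ 2 + ∑ j ∈ S, ‖f j‖ ^ 2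
    · exact ⟨Function.update ε i 1, hnorm 1 (by simp), by rwa [hsum, one_smul]⟩
    · refine ⟨Function.update ε i (-1), hnorm (-1) (by simp), ?_⟩
      rw [hsum, neg_one_smul, ← sub_eq_add_neg]
      nlinarith

lemma sum_norm_sq_starProjection {N : ℕ} (K : Submodule ℂ (EuclideanSpace ℂ (Fin N))) :
    ∑ i, ‖K.starProjection (EuclideanSpace.single i 1)‖ ^ 2 = Module.finrank ℂ K := by
  have hb := stdOrthonormalBasis ℂ K
  have h1 : ∀ i, ‖K.starProjection (EuclideanSpace.single i (1 : ℂ))‖ ^ 2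
      = ∑ j, ‖inner ℂ (EuclideanSpace.single i (1 : ℂ)) (hb j : EuclideanSpace ℂ (Fin N))‖ ^ 2 :=
    fun i => by
      rw [Submodule.starProjection_apply, ← Submodule.coe_norm, ← hb.sum_sq_norm_inner_left]
      refine Finset.sum_congr rfl fun j _ => ?_
      simp
  simp_rw [h1]
  rw [Finset.sum_comm]
  have h2 : ∀ j, ∑ i, ‖inner ℂ (EuclideanSpace.single i (1 : ℂ))
      (hb j : EuclideanSpace ℂ (Fin N))‖ ^ 2 = 1 := fun j => by
    simp_rw [EuclideanSpace.inner_single_left, map_one, one_mul]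
    rw [← EuclideanSpace.norm_sq_eq, ← Submodule.coe_norm, hb.orthonormal.1 j, one_pow]
  simp [h2]

lemma exists_mem_near_sign_vector {N k s : ℕ} (K : Submodule ℂ (EuclideanSpace ℂ (Fin N)))
    (hK : Module.finrank ℂ Kᗮ ≤ k) (hN : 0 < N) (hkN : 2 * k ≤ N) (hs : s ≤ N) :
    ∃ (S : Finset (Fin N)) (v x : EuclideanSpace ℂ (Fin N)), S.card = s ∧ x ∈ K ∧
      (∀ i ∈ S, ‖v i‖ = 1) ∧ (∀ i ∉ S, v i = 0) ∧ (s : ℝ) / 2 ≤ ∑ i ∈ S, ‖x i‖ ∧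
      ∑ i, ‖v i - x i‖ ^ 2 ≤ (s : ℝ) * k / N := by
  have hN' : (0 : ℝ) < N := by exact_mod_cast hN
  set Q := Kᗮ.starProjection with hQ
  obtain ⟨S, -, hS, hSle⟩ := exists_subset_card_eq_mul_sum_le
    (fun i => ‖Q (EuclideanSpace.single i 1)‖ ^ 2) s (N - s) (Finset.univ : Finset (Fin N))
    (by simp; omega)
  rw [sum_norm_sq_starProjection, Finset.card_univ, Fintype.card_fin] at hSle
  obtain ⟨ε, hε, hεle⟩ := exists_signs_norm_sum_sq_le (fun i => Q (EuclideanSpace.single i 1)) S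
  set v : EuclideanSpace ℂ (Fin N) := ∑ i ∈ S, ε i • EuclideanSpace.single i (1 : ℂ) with hv
  have hvi : ∀ j, v j = if j ∈ S then ε j else 0 := fun j => by
    simp [hv, Pi.single_apply]
  have hQv : ‖Q v‖ ^ 2 ≤ s * k / N := by
    rw [le_div_iff₀ hN', mul_comm]
    calc (N : ℝ) * ‖Q v‖ ^ 2 ≤ N * ∑ i ∈ S, ‖Q (EuclideanSpace.single i 1)‖ ^ 2 := by
          rw [hv, map_sum]; simp_rw [map_smul]; gcongr
      _ ≤ s * (Module.finrank ℂ Kᗮ : ℝ) := hSle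
      _ ≤ s * k := by gcongr
  have hxK : v - Q v ∈ K := by
    have := Kᗮ.sub_starProjection_mem_orthogonal v
    rwa [Submodule.orthogonal_orthogonal] at this
  have hvn : ‖v‖ ^ 2 = s := by
    rw [EuclideanSpace.norm_sq_eq]
    simp_rw [hvi, apply_ite norm, hε]
    simp [hS]
  refine ⟨S, v, v - Q v, hS, hxK, fun i hi => by simp [hvi, hi, hε], fun i hi => by simp [hvi, hi],
    ?_, ?_⟩
  · have h1 : inner ℂ v (v - Q v) = ∑ i ∈ S, (v - Q v) i * starRingEnd ℂ (ε i) := by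
      rw [PiLp.inner_apply, ← Finset.sum_subset S.subset_univ]
      · exact Finset.sum_congr rfl fun i hi => by simp [hvi, hi]
      · exact fun i _ hi => by simp [hvi, hi]
    have h2 : ‖inner ℂ v (v - Q v)‖ ≤ ∑ i ∈ S, ‖(v - Q v) i‖ := by
      rw [h1]
      refine (norm_sum_le _ _).trans_eq (Finset.sum_congr rfl fun i _ => ?_)
      rw [norm_mul, RCLike.norm_conj, hε, mul_one]
    refine le_trans ?_ ((RCLike.re_le_norm _).trans h2)
    rw [inner_sub_right, map_sub, inner_self_eq_norm_sq, hvn, ← inner_conj_symm, RCLike.conj_re,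
      hQ, Submodule.re_inner_starProjection_eq_normSq]
    rw [hQ, Submodule.starProjection_apply, ← Submodule.coe_norm] at hQv
    have h3 : (s : ℝ) * k / N ≤ s / 2 := by
      rw [div_le_div_iff₀ hN' two_pos, mul_assoc]
      gcongr
      exact_mod_cast (mul_comm k 2).trans_le hkN
    linarith
  · rw [EuclideanSpace.norm_sq_eq] at hQv
    simpa using hQv

lemma lp_norm_le_card_rpow_mul {ι : Type*} (S : Finset ι) {y : ι → ℝ} (hy : ∀ i, 0 ≤ y i)
    {p q : ℝ} (hp : 0 < p) (hpq : p ≤ q) :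
    (∑ i ∈ S, y i ^ p) ^ (1 / p) ≤
      (S.card : ℝ) ^ (1 / p - 1 / q) * (∑ i ∈ S, y i ^ q) ^ (1 / q) := by
  have hq : 0 < q := hp.trans_le hpq
  have h := Real.rpow_sum_le_const_mul_sum_rpow S (fun i => y i ^ p) ((one_le_div hp).2 hpq)
  have h1 : ∀ i, |y i ^ p| = y i ^ p := fun i => abs_of_nonneg (Real.rpow_nonneg (hy i) p)
  have h2 : ∀ i, (y i ^ p) ^ (q / p) = y i ^ q := fun i => by
    rw [← Real.rpow_mul (hy i), mul_div_cancel₀ _ hp.ne']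
  simp_rw [h1, h2] at h
  have h0 : 0 ≤ ∑ i ∈ S, y i ^ p := Finset.sum_nonneg fun i _ => Real.rpow_nonneg (hy i) p
  have h0' : 0 ≤ ∑ i ∈ S, y i ^ q := Finset.sum_nonneg fun i _ => Real.rpow_nonneg (hy i) q
  have h3 := Real.rpow_le_rpow (by positivity) h (by positivity : 0 ≤ 1 / q)
  rw [← Real.rpow_mul h0, Real.mul_rpow (by positivity) h0', ← Real.rpow_mul (by positivity)] at h3
  convert h3 using 2 <;> [skip; congr 1] <;> field_simp

lemma exists_mem_lp_norm_le_of_card {N k s : ℕ} (K : Submodule ℂ (EuclideanSpace ℂ (Fin N)))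
    (hK : Module.finrank ℂ Kᗮ ≤ k) (hkN : 2 * k ≤ N) (hs1 : 1 ≤ s) (hs : s ≤ N)
    {p q : ℝ} (hp : 1 < p) (hpq : p < q) (hq : q ≤ 2)
    (hsk : (k : ℝ) ^ (1/2 : ℝ) * (N : ℝ) ^ (1 / p - 1) ≤ (s : ℝ) ^ (1 / p - 1 / 2)) :
    ∃ x ∈ K, x ≠ 0 ∧ (s : ℝ) ^ (1 / q - 1 / p) / 4 * (∑ i, ‖x i‖ ^ p) ^ (1 / p) ≤
      (∑ i, ‖x i‖ ^ q) ^ (1 / q) := by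
  have hN : 0 < N := by omega
  have hN' : (0 : ℝ) < N := by exact_mod_cast hN
  have hs' : (0 : ℝ) < s := by exact_mod_cast hs1
  have hp0 : 0 < p := by linarith
  have hq0 : 0 < q := by linarith
  obtain ⟨S, v, x, hS, hxK, hv1, hv0, hsum, hvx⟩ := exists_mem_near_sign_vector K hK hN hkN hs
  have hvp : (∑ i, ‖v i‖ ^ p) ^ (1 / p) = (s : ℝ) ^ (1 / p) := by
    rw [← Finset.sum_subset S.subset_univ fun i _ hi => by
      rw [hv0 i hi, norm_zero, Real.zero_rpow hp0.ne'],
      Finset.sum_congr rfl fun i hi => by rw [hv1 i hi, Real.one_rpow]]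
    simp [hS]
  have hdiff : (∑ i, ‖v i - x i‖ ^ p) ^ (1 / p) ≤ (s : ℝ) ^ (1 / p) := by
    have h1 := lp_norm_le_card_rpow_mul Finset.univ (fun i => norm_nonneg (v i - x i)) hp0
      (hpq.le.trans hq)
    rw [Finset.card_univ, Fintype.card_fin] at h1
    simp_rw [Real.rpow_ofNat] at h1
    calc (∑ i, ‖v i - x i‖ ^ p) ^ (1 / p)
        ≤ (N : ℝ) ^ (1 / p - 1 / 2) * ((s : ℝ) * k / N) ^ (1 / 2 : ℝ) := h1.trans (by gcongr)
      _ = (s : ℝ) ^ (1 / 2 : ℝ) * ((k : ℝ) ^ (1/2 : ℝ) * (N : ℝ) ^ (1 / p - 1)) := by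
        rw [Real.div_rpow (by positivity) hN'.le, Real.mul_rpow hs'.le (Nat.cast_nonneg k),
          show 1 / p - 1 = (1 / p - 1 / 2) - 1 / 2 by ring, Real.rpow_sub hN' (1 / p - 1 / 2)]
        ring
      _ ≤ (s : ℝ) ^ (1 / 2 : ℝ) * (s : ℝ) ^ (1 / p - 1 / 2) := by gcongr
      _ = (s : ℝ) ^ (1 / p) := by rw [← Real.rpow_add hs']; ring_nf
  have hxp : (∑ i, ‖x i‖ ^ p) ^ (1 / p) ≤ 2 * (s : ℝ) ^ (1 / p) := by
    have h1 : (∑ i, ‖x i‖ ^ p) ^ (1 / p) ≤ (∑ i, (‖v i‖ + ‖v i - x i‖) ^ p) ^ (1 / p) := by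
      gcongr with i
      have := norm_sub_le (v i) (v i - x i)
      rwa [sub_sub_cancel] at this
    have h2 := Real.Lp_add_le_of_nonneg Finset.univ hp.le
      (fun i _ => norm_nonneg (v i)) (fun i _ => norm_nonneg (v i - x i))
    linarith
  have hxq : (s : ℝ) ^ (1 / q) / 2 ≤ (∑ i, ‖x i‖ ^ q) ^ (1 / q) := by
    have h1 := lp_norm_le_card_rpow_mul S (fun i => norm_nonneg (x i)) one_pos (hp.trans hpq).le
    simp only [Real.rpow_one, hS, div_one] at h1
    have h2 : (∑ i ∈ S, ‖x i‖ ^ q) ^ (1 / q) ≤ (∑ i, ‖x i‖ ^ q) ^ (1 / q) := by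
      gcongr
      exact S.subset_univ
    have h3 : (s : ℝ) ^ (1 - 1 / q) * (s : ℝ) ^ (1 / q) = s := by
      rw [← Real.rpow_add hs']; simp
    refine le_of_mul_le_mul_left ?_ (Real.rpow_pos_of_pos hs' (1 - 1 / q))
    have h4 := mul_le_mul_of_nonneg_left h2 (Real.rpow_nonneg hs'.le (1 - 1 / q))
    linarith
  refine ⟨x, hxK, ?_, ?_⟩
  · rintro rfl
    simp at hsum
    linarith
  · calc (s : ℝ) ^ (1 / q - 1 / p) / 4 * (∑ i, ‖x i‖ ^ p) ^ (1 / p)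
        ≤ (s : ℝ) ^ (1 / q - 1 / p) / 4 * (2 * (s : ℝ) ^ (1 / p)) := by gcongr
      _ = (s : ℝ) ^ (1 / q - 1 / p) * (s : ℝ) ^ (1 / p) / 2 := by ring
      _ = (s : ℝ) ^ (1 / q) / 2 := by rw [← Real.rpow_add hs']; simp
      _ ≤ _ := hxq

lemma exists_card_rpow_bound {p q : ℝ} (hp : 1 < p) (hpq : p < q) (hq : q ≤ 2) {N k : ℕ}
    (hk : 1 ≤ k) (hkN : k ≤ N) :
    ∃ s : ℕ, 1 ≤ s ∧ s ≤ N ∧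
      (k : ℝ) ^ (1/2 : ℝ) * (N : ℝ) ^ (1 / p - 1) ≤ (s : ℝ) ^ (1 / p - 1 / 2) ∧
      (2 : ℝ) ^ (1 / q - 1 / p) * (min 1 ((N : ℝ) ^ (1 - 1 / p) * (k : ℝ) ^ (-(1/2) : ℝ))) ^
        ((1 / p - 1 / q) / (1 / p - 1 / 2)) ≤ (s : ℝ) ^ (1 / q - 1 / p) := by
  have hk0 : (0 : ℝ) < k := by exact_mod_cast hk
  have hN1 : (1 : ℝ) ≤ N := by exact_mod_cast hk.trans hkN
  have hN0 : (0 : ℝ) < N := by linarith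
  have hp0 : 0 < p := by linarith
  set e := 1 / p - 1 / 2 with he
  have he0 : 0 < e := sub_pos.2 (one_div_lt_one_div_of_lt hp0 (by linarith))
  have hpq' : 1 / q - 1 / p ≤ 0 := sub_nonpos.2 (one_div_le_one_div_of_le hp0 hpq.le)
  set t := (k : ℝ) ^ (1/2 : ℝ) * (N : ℝ) ^ (1 / p - 1) with ht
  have ht0 : 0 < t := by positivity
  have htinv : (N : ℝ) ^ (1 - 1 / p) * (k : ℝ) ^ (-(1/2) : ℝ) = t⁻¹ := by
    rw [ht, mul_inv, Real.rpow_neg hk0.le, mul_comm, ← Real.rpow_neg hN0.le, neg_sub]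
  have htN : t ≤ (N : ℝ) ^ e := by
    calc t ≤ (N : ℝ) ^ (1/2 : ℝ) * (N : ℝ) ^ (1 / p - 1) := by
          rw [ht]; gcongr
      _ = (N : ℝ) ^ e := by rw [← Real.rpow_add hN0, he]; ring_nf
  set u := (max 1 t) ^ (1 / e) with hu
  have hm : 1 ≤ max 1 t := le_max_left _ _
  have hm0 : 0 < max 1 t := by positivity
  have hu1 : 1 ≤ u := Real.one_le_rpow hm (by positivity)
  have hue : u ^ e = max 1 t := by
    rw [hu, ← Real.rpow_mul hm0.le, one_div_mul_cancel he0.ne', Real.rpow_one]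
  have huN : u ≤ N := by
    rw [← Real.rpow_le_rpow_iff (by positivity) hN0.le he0, hue]
    exact max_le (Real.one_le_rpow hN1 he0.le) htN
  have hs1 : 1 ≤ ⌈u⌉₊ := Nat.one_le_iff_ne_zero.2 (Nat.ceil_pos.2 (by linarith)).ne'
  have hs0 : (0 : ℝ) < (⌈u⌉₊ : ℝ) := by exact_mod_cast hs1
  refine ⟨⌈u⌉₊, hs1, Nat.ceil_le.2 huN, ?_, ?_⟩
  · calc t ≤ u ^ e := hue ▸ le_max_right _ _
      _ ≤ _ := by gcongr; exact Nat.le_ceil u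
  · have hmin : min 1 t⁻¹ = u ^ (-e) := by
      rw [Real.rpow_neg (by linarith), hue]
      rcases le_total 1 t with h | h
      · rw [max_eq_right h, min_eq_right (inv_le_one_of_one_le₀ h)]
      · rw [max_eq_left h, min_eq_left ((one_le_inv₀ ht0).2 h), inv_one]
    have hexp : -e * ((1 / p - 1 / q) / e) = 1 / q - 1 / p := by field_simp; ring
    rw [htinv, hmin, ← Real.rpow_mul (by linarith), hexp, ← Real.mul_rpow two_pos.le (by linarith)]
    refine Real.rpow_le_rpow_of_nonpos hs0 ?_ hpq'
    have := Nat.ceil_lt_add_one (show 0 ≤ u by linarith)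
    linarith

lemma exists_mem_lp_norm_le {p q : ℝ} (hp : 1 < p) (hpq : p < q) (hq : q ≤ 2) :
    ∃ c : ℝ, 0 < c ∧ ∀ N k : ℕ, 1 ≤ k → k ≤ N → ∀ K : Submodule ℂ (EuclideanSpace ℂ (Fin N)),
      Module.finrank ℂ Kᗮ < k → ∃ x ∈ K, x ≠ 0 ∧
      c * (min 1 ((N : ℝ) ^ (1 - 1 / p) * (k : ℝ) ^ (-(1/2) : ℝ))) ^
        ((1 / p - 1 / q) / (1 / p - 1 / 2)) * (∑ i, ‖x i‖ ^ p) ^ (1 / p) ≤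
      (∑ i, ‖x i‖ ^ q) ^ (1 / q) := by
  have hp0 : 0 < p := by linarith
  have he0 : 0 < 1 / p - 1 / 2 := sub_pos.2 (one_div_lt_one_div_of_lt hp0 (by linarith))
  have hpq' : 0 < 1 / p - 1 / q := sub_pos.2 (one_div_lt_one_div_of_lt hp0 hpq)
  set θ := (1 / p - 1 / q) / (1 / p - 1 / 2) with hθ
  have hθ0 : 0 < θ := div_pos hpq' he0
  refine ⟨min ((2 : ℝ) ^ (1 / q - 1 / p) / 4) ((2 : ℝ) ^ (-(θ / 2))), by positivity,
    fun N k hk hkN K hK => ?_⟩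
  have hk0 : (0 : ℝ) < k := by exact_mod_cast hk
  have hN0 : (0 : ℝ) < N := by exact_mod_cast hk.trans hkN
  set ξ := min 1 ((N : ℝ) ^ (1 - 1 / p) * (k : ℝ) ^ (-(1/2) : ℝ)) with hξ
  have hξ0 : 0 ≤ ξ := by positivity
  have hξθ : 0 ≤ ξ ^ θ := by positivity
  rcases le_or_gt (2 * k) N with h2k | h2k
  · obtain ⟨s, hs1, hsN, hsk, hsξ⟩ := exists_card_rpow_bound hp hpq hq hk hkN
    obtain ⟨x, hxK, hx0, hx⟩ := exists_mem_lp_norm_le_of_card K hK.le h2k hs1 hsN hp hpq hq hsk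
    refine ⟨x, hxK, hx0, le_trans ?_ hx⟩
    gcongr
    have := mul_le_mul_of_nonneg_right
      (min_le_left ((2 : ℝ) ^ (1 / q - 1 / p) / 4) ((2 : ℝ) ^ (-(θ / 2)))) hξθ
    linarith
  · have hK0 : K ≠ ⊥ := by
      intro h
      rw [h, Submodule.bot_orthogonal_eq_top, finrank_top, finrank_euclideanSpace_fin] at hK
      omega
    obtain ⟨x, hxK, hx0⟩ := K.ne_bot_iff.1 hK0
    refine ⟨x, hxK, hx0, ?_⟩
    have h1 := lp_norm_le_card_rpow_mul Finset.univ (fun i => norm_nonneg (x i)) hp0 hpq.le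
    rw [Finset.card_univ, Fintype.card_fin] at h1
    have h2 : ξ ≤ (2 : ℝ) ^ (1/2 : ℝ) * (N : ℝ) ^ (-(1 / p - 1 / 2)) := by
      calc ξ ≤ (N : ℝ) ^ (1 - 1 / p) * (k : ℝ) ^ (-(1/2) : ℝ) := min_le_right _ _
        _ ≤ (N : ℝ) ^ (1 - 1 / p) * ((N : ℝ) / 2) ^ (-(1/2) : ℝ) := by
          refine mul_le_mul_of_nonneg_left
            (Real.rpow_le_rpow_of_nonpos (by positivity) ?_ (by norm_num)) (by positivity)
          have : (N : ℝ) < 2 * k := by exact_mod_cast h2k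
          linarith
        _ = _ := by
          rw [Real.div_rpow hN0.le two_pos.le, Real.rpow_neg two_pos.le, div_inv_eq_mul, ← mul_assoc,
            ← Real.rpow_add hN0, mul_comm]
          ring_nf
    have h3 : (2 : ℝ) ^ (-(θ / 2)) * ξ ^ θ ≤ (N : ℝ) ^ (-(1 / p - 1 / q)) := by
      calc (2 : ℝ) ^ (-(θ / 2)) * ξ ^ θ
          ≤ (2 : ℝ) ^ (-(θ / 2)) * ((2 : ℝ) ^ (1/2 : ℝ) * (N : ℝ) ^ (-(1 / p - 1 / 2))) ^ θ := by
            gcongr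
        _ = (2 : ℝ) ^ (-(θ / 2) + 1 / 2 * θ) * (N : ℝ) ^ (-(1 / p - 1 / 2) * θ) := by
            rw [Real.mul_rpow (by positivity) (by positivity), ← Real.rpow_mul two_pos.le,
              ← Real.rpow_mul hN0.le, Real.rpow_add two_pos, mul_assoc]
        _ = (N : ℝ) ^ (-(1 / p - 1 / q)) := by
            rw [neg_mul, hθ, mul_div_cancel₀ _ he0.ne', ← hθ,
              show -(θ / 2) + 1 / 2 * θ = 0 by ring, Real.rpow_zero, one_mul]
    have h4 : 0 ≤ (∑ i, ‖x i‖ ^ p) ^ (1 / p) := by positivity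
    calc _ ≤ (N : ℝ) ^ (-(1 / p - 1 / q)) * (∑ i, ‖x i‖ ^ p) ^ (1 / p) := by
          gcongr
          exact (mul_le_mul_of_nonneg_right (min_le_right _ _) hξθ).trans h3
      _ ≤ (N : ℝ) ^ (-(1 / p - 1 / q)) *
          ((N : ℝ) ^ (1 / p - 1 / q) * (∑ i, ‖x i‖ ^ q) ^ (1 / q)) := by gcongr
      _ = _ := by
          rw [← mul_assoc, ← Real.rpow_add hN0, neg_add_cancel, Real.rpow_zero, one_mul]

lemma inv_conjExp_toReal {p : ℝ≥0∞} (hp : 1 ≤ p) : ((conjExp p)⁻¹).toReal = 1 - 1 / p.toReal := by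
  rw [conjExp, inv_inv, ENNReal.toReal_sub_of_le (ENNReal.inv_le_one.2 hp) ENNReal.one_ne_top,
    ENNReal.toReal_inv, ENNReal.toReal_one, one_div]

lemma one_lt_toReal {p : ℝ≥0∞} (hp : 1 < p) (hp' : p ≠ ∞) : 1 < p.toReal := by
  simpa using (ENNReal.toReal_lt_toReal ENNReal.one_ne_top hp').2 hp

lemma exists_gelfandNumber_lpId_le (p₁ p₂ : ℝ≥0∞) [Fact (1 ≤ p₁)] [Fact (1 ≤ p₂)]
    (h₀ : 1 < p₁) (h₁ : p₁ < p₂) (h₂ : p₂ ≤ 2) :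
    ∃ c : ℝ, ∀ N k : ℕ, 1 ≤ k → k ≤ N → gelfandNumber (lpId p₁ p₂ N) k ≤
      c * (min 1 ((N : ℝ) ^ (1 - 1 / p₁.toReal) * (k : ℝ) ^ (-(1/2) : ℝ))) ^
        ((1 / p₁.toReal - 1 / p₂.toReal) / (1 / p₁.toReal - 1 / 2)) := by
  have h₂' : p₂ ≠ ∞ := (h₂.trans_lt ENNReal.ofNat_lt_top).ne
  have hp : 1 < p₁.toReal := one_lt_toReal h₀ h₁.ne_top
  have hpq : p₁.toReal < p₂.toReal := (ENNReal.toReal_lt_toReal h₁.ne_top h₂').2 h₁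
  have hq : p₂.toReal ≤ 2 := by simpa using ENNReal.toReal_mono ENNReal.ofNat_ne_top h₂
  set p := p₁.toReal with hpdef
  set q := p₂.toReal with hqdef
  have hp0 : 0 < p := by linarith
  have hq0 : 0 < q := by linarith
  have h2p : 0 < 2 - p := by linarith
  obtain ⟨C, hC, H⟩ := exists_linearMap_ker_le hp (hpq.le.trans hq)
  refine ⟨C ^ ((1 / p - 1 / q) / (1 / p - 1 / 2)), fun N k hk hkN => ?_⟩
  obtain ⟨m, hm, g, hg⟩ := H N k hk hkN
  set ξ := min 1 ((N : ℝ) ^ (1 - 1 / p) * (k : ℝ) ^ (-(1/2) : ℝ)) with hξ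
  have hξ0 : 0 ≤ ξ := by positivity
  refine gelfandNumber_le _ hm (g ∘ₗ (WithLp.linearEquiv p₁ ℂ (Fin N → ℂ)).toLinearMap)
    fun x hx hx1 => ?_
  have hsum : ∑ j, ‖x j‖ ^ p ≤ 1 := by
    rw [PiLp.norm_eq_sum hp0] at hx1
    by_contra! h
    exact hx1.not_gt (Real.one_lt_rpow h (by positivity))
  have hsq := hg x.ofLp hx hsum
  have hTq := sum_rpow_le_of_sum_rpow_le_one Finset.univ (fun j => norm_nonneg (x j)) hp0 hpq hq hsum
  have hnorm : ‖lpId p₁ p₂ N x‖ = (∑ j, ‖x j‖ ^ q) ^ (1 / q) := PiLp.norm_eq_sum hq0 _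
  rw [hnorm]
  have ht : 0 ≤ (q - p) / (2 - p) := div_nonneg (by linarith) h2p.le
  calc (∑ j, ‖x j‖ ^ q) ^ (1 / q)
      ≤ ((((C * ξ) ^ 2) ^ ((q - p) / (2 - p)))) ^ (1 / q) := by
        gcongr
        exact hTq.trans (by gcongr)
    _ = (C * ξ) ^ ((1 / p - 1 / q) / (1 / p - 1 / 2)) := by
        rw [← Real.rpow_natCast, ← Real.rpow_mul (by positivity), ← Real.rpow_mul (by positivity)]
        congr 1
        have : 1 / p - 1 / 2 = (2 - p) / (2 * p) := by field_simp
        rw [this]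
        field_simp
        push_cast
        ring
    _ = _ := Real.mul_rpow hC.le hξ0

lemma exists_le_gelfandNumber_lpId (p₁ p₂ : ℝ≥0∞) [Fact (1 ≤ p₁)] [Fact (1 ≤ p₂)]
    (h₀ : 1 < p₁) (h₁ : p₁ < p₂) (h₂ : p₂ ≤ 2) :
    ∃ c : ℝ, 0 < c ∧ ∀ N k : ℕ, 1 ≤ k → k ≤ N →
      c * (min 1 ((N : ℝ) ^ (1 - 1 / p₁.toReal) * (k : ℝ) ^ (-(1/2) : ℝ))) ^
        ((1 / p₁.toReal - 1 / p₂.toReal) / (1 / p₁.toReal - 1 / 2)) ≤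
      gelfandNumber (lpId p₁ p₂ N) k := by
  have h₂' : p₂ ≠ ∞ := (h₂.trans_lt ENNReal.ofNat_lt_top).ne
  have hp : 1 < p₁.toReal := one_lt_toReal h₀ h₁.ne_top
  have hpq : p₁.toReal < p₂.toReal := (ENNReal.toReal_lt_toReal h₁.ne_top h₂').2 h₁
  have hq : p₂.toReal ≤ 2 := by simpa using ENNReal.toReal_mono ENNReal.ofNat_ne_top h₂
  obtain ⟨c, hc, H⟩ := exists_mem_lp_norm_le hp hpq hq
  refine ⟨c, hc, fun N k hk hkN => le_gelfandNumber _ hk fun M hM => ?_⟩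
  let φ : PiLp p₁ (fun _ : Fin N => ℂ) ≃ₗ[ℂ] EuclideanSpace ℂ (Fin N) :=
    (WithLp.linearEquiv p₁ ℂ (Fin N → ℂ)).trans (WithLp.linearEquiv 2 ℂ (Fin N → ℂ)).symm
  have hK := (M.map φ.toLinearMap).finrank_add_finrank_orthogonal
  rw [LinearEquiv.finrank_map_eq, ← φ.finrank_eq] at hK
  obtain ⟨_, ⟨x, hxM, rfl⟩, hx0, hx⟩ := H N k hk hkN (M.map φ.toLinearMap) (by omega)
  refine ⟨x, hxM, fun h => hx0 (by rw [h, map_zero]), ?_⟩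
  rw [PiLp.norm_eq_sum (by linarith), PiLp.norm_eq_sum (by linarith)]
  exact hx

/-- If `1 < p₁ < p₂ ≤ 2` and `θ₁ = (1/p₂′ - 1/p₁′)/(1/2 - 1/p₁′)`, then
`c_k(id : ℓ_{p₁}^N → ℓ_{p₂}^N) ∼ ξ^{θ₁}` for `k ≤ N`, where `ξ = min(1, N^{1/p₁′} k^{-1/2})`. -/
theorem stmt13 (p₁ p₂ : ℝ≥0∞) [Fact (1 ≤ p₁)] [Fact (1 ≤ p₂)]
    (h₀ : 1 < p₁) (h₁ : p₁ < p₂) (h₂ : p₂ ≤ 2) :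
    ∃ c₁ c₂ : ℝ, 0 < c₁ ∧ c₁ ≤ c₂ ∧
      ∀ N k : ℕ, 1 ≤ k → k ≤ N →
        c₁ * (min 1 ((N : ℝ) ^ (((conjExp p₁)⁻¹).toReal) * (k : ℝ) ^ (-(1/2) : ℝ)))
              ^ ((((conjExp p₂)⁻¹).toReal - ((conjExp p₁)⁻¹).toReal)
                  / (1/2 - ((conjExp p₁)⁻¹).toReal))
            ≤ gelfandNumber (lpId p₁ p₂ N) k ∧
        gelfandNumber (lpId p₁ p₂ N) k
            ≤ c₂ * (min 1 ((N : ℝ) ^ (((conjExp p₁)⁻¹).toReal) * (k : ℝ) ^ (-(1/2) : ℝ)))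
              ^ ((((conjExp p₂)⁻¹).toReal - ((conjExp p₁)⁻¹).toReal)
                  / (1/2 - ((conjExp p₁)⁻¹).toReal)) := by
  obtain ⟨c₁, hc₁, hlow⟩ := exists_le_gelfandNumber_lpId p₁ p₂ h₀ h₁ h₂
  obtain ⟨c₂, hup⟩ := exists_gelfandNumber_lpId_le p₁ p₂ h₀ h₁ h₂
  rw [inv_conjExp_toReal h₀.le, inv_conjExp_toReal (h₀.trans h₁).le,
    show 1 - 1 / p₂.toReal - (1 - 1 / p₁.toReal) = 1 / p₁.toReal - 1 / p₂.toReal by ring,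
    show 1 / 2 - (1 - 1 / p₁.toReal) = 1 / p₁.toReal - 1 / 2 by ring]
  refine ⟨c₁, max c₁ c₂, hc₁, le_max_left _ _, fun N k hk hkN => ⟨hlow N k hk hkN, ?_⟩⟩
  refine (hup N k hk hkN).trans ?_
  gcongr
  exact le_max_right _ _
end
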